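/- arXiv:2605.02514 — 2 statements merged into one kernel-verified Lean document; each statement's English description precedes it below -/
import Mathlib

section
/- For every graphon W on an arbitrary probability space (Ω, 𝒜, μ) there exists a graphon W' on the unit interval [0,1] equipped with Lebesgue measure λ such that W and W' are weakly isomorphic, i.e., t(F, W) = t(F, W') for every finite simple graph F. -/
open MeasureTheory unitInterval
open scoped Classical unitInterval

/-- The homomorphism density `t(F, W)` of a finite simple graph `F` (on vertex set `Fin m`)
in a kernel `W : Ω → Ω → ℝ` with respect to a measure `μ`. -/
noncomputable def homDensity {Ω : Type*} [MeasurableSpace Ω] (μ : Measure Ω)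
    (W : Ω → Ω → ℝ) {m : ℕ} (G : SimpleGraph (Fin m)) : ℝ :=
  ∫ x : Fin m → Ω,
    ∏ p ∈ Finset.univ.filter (fun p : Fin m × Fin m => p.1 < p.2 ∧ G.Adj p.1 p.2),
      W (x p.1) (x p.2) ∂(Measure.pi fun _ : Fin m => μ)

/-- `W` is a graphon on `(Ω, μ)`: a symmetric measurable function with values in `[0,1]`. -/
def IsGraphon {Ω : Type*} [MeasurableSpace Ω] (W : Ω → Ω → ℝ) : Prop :=
  Measurable (Function.uncurry W) ∧ (∀ x y, W x y = W y x) ∧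
    ∀ x y, W x y ∈ Set.Icc (0 : ℝ) 1

lemma graphonAux_combine {Ω : Type*} [MeasurableSpace Ω] (S : ℕ → Set (Ω × Ω))
    (h : ∀ n, ∃ φ : Ω → (ℕ → Bool), Measurable φ ∧
      ∃ T : Set ((ℕ → Bool) × (ℕ → Bool)), MeasurableSet T ∧ Prod.map φ φ ⁻¹' T = S n) :
    ∃ φ : Ω → (ℕ → Bool), Measurable φ ∧ ∀ n,
      ∃ T : Set ((ℕ → Bool) × (ℕ → Bool)), MeasurableSet T ∧ Prod.map φ φ ⁻¹' T = S n := by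
  choose φ hφ T hT hS using h
  refine ⟨fun x k => φ k.unpair.1 x k.unpair.2, ?_, fun n => ?_⟩
  · refine measurable_pi_lambda _ fun k => ?_
    exact (measurable_pi_apply _).comp (hφ _)
  · let π : (ℕ → Bool) → (ℕ → Bool) := fun c k => c (Nat.pair n k)
    have hπ : Measurable π := measurable_pi_lambda _ fun k => measurable_pi_apply _
    refine ⟨Prod.map π π ⁻¹' T n, (hπ.prodMap hπ) (hT n), ?_⟩
    rw [← hS n, ← Set.preimage_comp]
    congr 1
    funext p
    simp [π, Prod.map]

lemma graphonAux_set {Ω : Type*} [MeasurableSpace Ω] (S : Set (Ω × Ω)) (hS : MeasurableSet S) :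
    ∃ φ : Ω → (ℕ → Bool), Measurable φ ∧
      ∃ T : Set ((ℕ → Bool) × (ℕ → Bool)), MeasurableSet T ∧ Prod.map φ φ ⁻¹' T = S := by
  have key : ∀ A : Set Ω, MeasurableSet A → ∃ φ : Ω → (ℕ → Bool), Measurable φ ∧
      ∃ B : Set (ℕ → Bool), MeasurableSet B ∧ φ ⁻¹' B = A := by
    intro A hA
    refine ⟨fun x _ => decide (x ∈ A), ?_, {c | c 0 = true}, ?_, ?_⟩
    · refine measurable_pi_lambda _ fun k => measurable_to_bool ?_
      convert hA using 1
      ext x; simp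
    · have h0 : Measurable fun c : ℕ → Bool => c 0 := measurable_pi_apply 0
      exact h0 (MeasurableSet.singleton true)
    · ext x; simp
  rw [← generateFrom_prod] at hS
  induction S, hS using MeasurableSpace.generateFrom_induction with
  | hC S hS _ =>
    obtain ⟨A, hA, B, hB, rfl⟩ := hS
    obtain ⟨f, hf, A', hA', rfl⟩ := key A hA
    obtain ⟨g, hg, B', hB', rfl⟩ := key B hB
    obtain ⟨φ, hφ, hc⟩ := graphonAux_combine
      (fun n : ℕ => if n = 0 then Prod.fst ⁻¹' (f ⁻¹' A') else Prod.snd ⁻¹' (g ⁻¹' B'))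
      (fun n => by
        by_cases h : n = 0
        · simp only [h, if_true]
          exact ⟨f, hf, Prod.fst ⁻¹' A', measurable_fst hA', rfl⟩
        · simp only [h, if_false]
          exact ⟨g, hg, Prod.snd ⁻¹' B', measurable_snd hB', rfl⟩)
    obtain ⟨T0, hT0, h0⟩ := hc 0
    obtain ⟨T1, hT1, h1⟩ := hc 1
    refine ⟨φ, hφ, T0 ∩ T1, hT0.inter hT1, ?_⟩
    rw [Set.preimage_inter, h0, h1]
    simp [Set.prod_eq]
  | empty => exact ⟨fun _ _ => true, measurable_const, ∅, MeasurableSet.empty, rfl⟩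
  | compl S _ ih =>
    obtain ⟨φ, hφ, T, hT, rfl⟩ := ih
    exact ⟨φ, hφ, Tᶜ, hT.compl, rfl⟩
  | iUnion S _ ih =>
    obtain ⟨φ, hφ, hc⟩ := graphonAux_combine S ih
    choose T hT h using hc
    refine ⟨φ, hφ, ⋃ n, T n, MeasurableSet.iUnion hT, ?_⟩
    simp [h]

lemma graphonAux_fun {Ω : Type*} [MeasurableSpace Ω] (f : Ω × Ω → ℝ) (hf : Measurable f) :
    ∃ φ : Ω → (ℕ → Bool), Measurable φ ∧
      ∃ V : (ℕ → Bool) × (ℕ → Bool) → ℝ, Measurable V ∧ f = V ∘ Prod.map φ φ := by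
  obtain ⟨e, he⟩ := exists_surjective_nat ℚ
  obtain ⟨φ, hφ, hc⟩ := graphonAux_combine (fun n => f ⁻¹' Set.Iio (e n : ℝ))
    (fun n => graphonAux_set _ (hf measurableSet_Iio))
  refine ⟨φ, hφ, ?_⟩
  have hm : Measurable[MeasurableSpace.comap (Prod.map φ φ) inferInstance] f := by
    letI : MeasurableSpace (Ω × Ω) := MeasurableSpace.comap (Prod.map φ φ) inferInstance
    rw [BorelSpace.measurable_eq (α := ℝ), Real.borel_eq_generateFrom_Iio_rat]
    refine measurable_generateFrom fun t ht => ?_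
    simp only [Set.mem_iUnion, Set.mem_singleton_iff] at ht
    obtain ⟨q, rfl⟩ := ht
    obtain ⟨n, rfl⟩ := he q
    exact hc n
  obtain ⟨V, hV, h⟩ := hm.exists_eq_measurable_comp
  exact ⟨V, hV, h⟩

lemma graphonAux_density {Ω Ω' : Type*} [MeasurableSpace Ω] [MeasurableSpace Ω']
    (μ : Measure Ω) [IsProbabilityMeasure μ] (ν : Measure Ω') [IsProbabilityMeasure ν]
    (φ : Ω → Ω') (hφ : MeasurePreserving φ μ ν) (V : Ω' → Ω' → ℝ)
    (hV : Measurable (Function.uncurry V)) {m : ℕ} (G : SimpleGraph (Fin m)) :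
    homDensity μ (fun x y => V (φ x) (φ y)) G = homDensity ν V G := by
  unfold homDensity
  have h := measurePreserving_pi (fun _ : Fin m => μ) (fun _ : Fin m => ν) (fun _ => hφ)
  rw [← h.map_eq, integral_map h.measurable.aemeasurable]
  refine (Measurable.aestronglyMeasurable ?_)
  refine Finset.measurable_prod _ fun p _ => ?_
  have h1 : Measurable fun x : Fin m → Ω' => (x p.1, x p.2) :=
    (measurable_pi_apply p.1).prodMk (measurable_pi_apply p.2)
  exact hV.comp h1

/-- every graphon on an arbitrary probability space is weakly isomorphic to a
graphon on the unit interval `[0,1]` with Lebesgue measure: there is a graphon `W'` on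
`[0,1]` with the same homomorphism densities for every finite simple graph. -/
theorem exists_graphon_on_unitInterval_weaklyIsomorphic
    {Ω : Type*} [MeasurableSpace Ω] (μ : Measure Ω) [IsProbabilityMeasure μ]
    (W : Ω → Ω → ℝ) (hW : IsGraphon W) :
    ∃ W' : I → I → ℝ, IsGraphon W' ∧
      ∀ (m : ℕ) (G : SimpleGraph (Fin m)),
        homDensity μ W G = homDensity (volume : Measure I) W' G := by
  obtain ⟨hm, hs, hb⟩ := hW
  obtain ⟨φ, hφ, V, hV, h⟩ := graphonAux_fun _ hm
  have hWV : ∀ x y, W x y = V (φ x, φ y) := fun x y => congrFun h (x, y)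
  let U : (ℕ → Bool) → (ℕ → Bool) → ℝ := fun a b =>
    max 0 (min 1 ((V (a, b) + V (b, a)) / 2))
  have hU : Measurable (Function.uncurry U) := by
    have h2 : Measurable fun p : (ℕ → Bool) × (ℕ → Bool) => V (p.2, p.1) :=
      hV.comp measurable_swap
    exact measurable_const.max (measurable_const.min ((hV.add h2).div_const 2))
  have hWU : W = fun x y => U (φ x) (φ y) := by
    funext x y
    have h1 := hb x y
    have h2 : (V (φ x, φ y) + V (φ y, φ x)) / 2 = W x y := by
      rw [← hWV, ← hWV, hs y x]; ring
    simp only [U, h2, min_eq_right h1.2, max_eq_right h1.1]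
  haveI : IsProbabilityMeasure (μ.map φ) := Measure.isProbabilityMeasure_map hφ.aemeasurable
  obtain ⟨ψ, hψ, hψm⟩ := (μ.map φ).exists_measurable_map_eq
  refine ⟨fun x y => U (ψ x) (ψ y), ⟨?_, ?_, ?_⟩, ?_⟩
  · exact hU.comp (hψ.prodMap hψ)
  · intro x y
    simp only [U, add_comm]
  · intro x y
    exact ⟨le_max_left _ _, max_le zero_le_one (min_le_left _ _)⟩
  · intro m G
    rw [hWU, graphonAux_density μ (μ.map φ) φ ⟨hφ, rfl⟩ U hU G,
      graphonAux_density volume (μ.map φ) ψ ⟨hψ, hψm⟩ U hU G]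
end

section
/- Let (W_n) be a sequence of graphons on ([0,1], λ) and W a graphon on ([0,1], λ). Then δ_□(W_n, W) → 0 as n → ∞ if and only if t(F, W_n) → t(F, W) for every finite simple graph F; that is, convergence in the cut metric is equivalent to convergence of all homomorphism densities. -/
open MeasureTheory unitInterval Filter
open scoped Classical unitInterval Topology

/-- The cut norm of a kernel on the unit interval. -/
noncomputable def cutNorm (U : I → I → ℝ) : ℝ :=
  sSup {r : ℝ | ∃ f g : I → ℝ, Measurable f ∧ Measurable g ∧
    (∀ x, |f x| ≤ 1) ∧ (∀ x, |g x| ≤ 1) ∧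
    r = |∫ p : I × I, U p.1 p.2 * f p.1 * g p.2
          ∂((volume : Measure I).prod (volume : Measure I))|}

/-- The cut metric `δ_□` on kernels on the unit interval: the infimum of the cut norm of
`U - W ∘ (φ × φ)` over all measure-preserving maps `φ : [0,1] → [0,1]`. -/
noncomputable def cutDist (U W : I → I → ℝ) : ℝ :=
  sInf {r : ℝ | ∃ φ : I → I, MeasurePreserving φ (volume : Measure I) (volume : Measure I) ∧
    r = cutNorm (fun x y => U x y - W (φ x) (φ y))}

/-- bounded measurable -/
def BM {α : Type*} [MeasurableSpace α] (f : α → ℝ) : Prop :=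
  Measurable f ∧ ∃ C, ∀ x, |f x| ≤ C

namespace BM
variable {α β : Type*} [MeasurableSpace α] [MeasurableSpace β]

lemma nonneg_bound {f : α → ℝ} (hf : BM f) : ∃ C, 0 ≤ C ∧ ∀ x, |f x| ≤ C := by
  obtain ⟨_, C, hC⟩ := hf
  exact ⟨max C 0, le_max_right _ _, fun x => (hC x).trans (le_max_left _ _)⟩

lemma integrable {f : α → ℝ} (hf : BM f) (μ : Measure α) [IsFiniteMeasure μ] :
    Integrable f μ := by
  obtain ⟨hm, C, hC⟩ := hf
  exact Integrable.of_bound hm.aestronglyMeasurable C (Eventually.of_forall hC)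

lemma const (c : ℝ) : BM (fun _ : α => c) := ⟨measurable_const, |c|, fun _ => le_rfl⟩

lemma add {f g : α → ℝ} (hf : BM f) (hg : BM g) : BM (fun x => f x + g x) := by
  obtain ⟨hm, C, hC⟩ := hf
  obtain ⟨hm', C', hC'⟩ := hg
  exact ⟨hm.add hm', C + C', fun x => (abs_add_le _ _).trans (add_le_add (hC x) (hC' x))⟩

lemma sub {f g : α → ℝ} (hf : BM f) (hg : BM g) : BM (fun x => f x - g x) := by
  obtain ⟨hm, C, hC⟩ := hf
  obtain ⟨hm', C', hC'⟩ := hg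
  exact ⟨hm.sub hm', C + C', fun x => (abs_sub _ _).trans (add_le_add (hC x) (hC' x))⟩

lemma mul {f g : α → ℝ} (hf : BM f) (hg : BM g) : BM (fun x => f x * g x) := by
  obtain ⟨C, h0, hC⟩ := hf.nonneg_bound
  obtain ⟨C', h0', hC'⟩ := hg.nonneg_bound
  refine ⟨hf.1.mul hg.1, C * C', fun x => ?_⟩
  rw [abs_mul]
  exact mul_le_mul (hC x) (hC' x) (abs_nonneg _) h0

lemma pow {f : α → ℝ} (hf : BM f) (n : ℕ) : BM (fun x => f x ^ n) := by
  induction n with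
  | zero => simpa using const 1
  | succ n ih => simpa only [pow_succ] using ih.mul hf

lemma abs {f : α → ℝ} (hf : BM f) : BM (fun x => |f x|) := by
  obtain ⟨hm, C, hC⟩ := hf
  exact ⟨hm.abs, C, fun x => by simpa using hC x⟩

lemma sum {ι : Type*} (s : Finset ι) {f : ι → α → ℝ} (hf : ∀ i ∈ s, BM (f i)) :
    BM (fun x => ∑ i ∈ s, f i x) := by
  induction s using Finset.induction_on with
  | empty => simpa using const 0
  | insert a s ha ih =>
    simp only [Finset.sum_insert ha]
    exact (hf a (by simp)).add (ih fun i hi => hf i (by simp [hi]))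

lemma prod {ι : Type*} (s : Finset ι) {f : ι → α → ℝ} (hf : ∀ i ∈ s, BM (f i)) :
    BM (fun x => ∏ i ∈ s, f i x) := by
  induction s using Finset.induction_on with
  | empty => simpa using const 1
  | insert a s ha ih =>
    simp only [Finset.prod_insert ha]
    exact (hf a (by simp)).mul (ih fun i hi => hf i (by simp [hi]))

lemma comp {f : β → ℝ} (hf : BM f) {φ : α → β} (hφ : Measurable φ) : BM (fun x => f (φ x)) := by
  obtain ⟨hm, C, hC⟩ := hf
  exact ⟨hm.comp hφ, C, fun x => hC _⟩

lemma abs_integral_le {f : α → ℝ} {C : ℝ} (hC : ∀ x, |f x| ≤ C)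
    (μ : Measure α) [IsProbabilityMeasure μ] : |∫ x, f x ∂μ| ≤ C := by
  have := norm_integral_le_of_norm_le_const (μ := μ) (f := f) (C := C) (Eventually.of_forall hC)
  simpa using this

lemma integral {f : α → β → ℝ} (hf : BM (fun p : α × β => f p.1 p.2)) (μ : Measure β)
    [IsProbabilityMeasure μ] : BM (fun x => ∫ y, f x y ∂μ) := by
  obtain ⟨hm, C, hC⟩ := hf
  refine ⟨?_, C, fun x => abs_integral_le (fun y => hC (x, y)) μ⟩
  exact (StronglyMeasurable.integral_prod_right (f := f) hm.stronglyMeasurable).measurable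

end BM

lemma IsGraphon.bm {Ω : Type*} [MeasurableSpace Ω] {W : Ω → Ω → ℝ} (h : IsGraphon W) :
    BM (fun p : Ω × Ω => W p.1 p.2) :=
  ⟨h.1, 1, fun p => abs_le.2 ⟨by linarith [(h.2.2 p.1 p.2).1], (h.2.2 p.1 p.2).2⟩⟩

lemma IsGraphon.abs_le {Ω : Type*} [MeasurableSpace Ω] {W : Ω → Ω → ℝ} (h : IsGraphon W) (x y : Ω) :
    |W x y| ≤ 1 :=
  _root_.abs_le.2 ⟨by linarith [(h.2.2 x y).1], (h.2.2 x y).2⟩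

noncomputable abbrev lam2 : Measure (I × I) := (volume : Measure I).prod (volume : Measure I)

lemma cutNorm_le {U : I → I → ℝ} {C : ℝ}
    (h : ∀ f g : I → ℝ, Measurable f → Measurable g → (∀ x, |f x| ≤ 1) → (∀ x, |g x| ≤ 1) →
      |∫ p : I × I, U p.1 p.2 * f p.1 * g p.2 ∂lam2| ≤ C) : cutNorm U ≤ C := by
  refine csSup_le ⟨_, 0, 0, measurable_const, measurable_const, by simp, by simp, rfl⟩ ?_
  rintro r ⟨f, g, hf, hg, hf1, hg1, rfl⟩
  exact h f g hf hg hf1 hg1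

lemma cutNorm_nonneg (U : I → I → ℝ) : 0 ≤ cutNorm U := by
  refine Real.sSup_nonneg ?_
  rintro r ⟨f, g, _, _, _, _, rfl⟩
  exact abs_nonneg _

lemma le_cutNorm {U : I → I → ℝ} (hU : BM (fun p : I × I => U p.1 p.2))
    {f g : I → ℝ} (hf : Measurable f) (hg : Measurable g)
    (hf1 : ∀ x, |f x| ≤ 1) (hg1 : ∀ x, |g x| ≤ 1) :
    |∫ p : I × I, U p.1 p.2 * f p.1 * g p.2 ∂lam2| ≤ cutNorm U := by
  refine le_csSup ?_ ⟨f, g, hf, hg, hf1, hg1, rfl⟩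
  obtain ⟨C, h0, hC⟩ := hU.nonneg_bound
  refine ⟨C, ?_⟩
  rintro r ⟨f, g, hf, hg, hf1, hg1, rfl⟩
  refine BM.abs_integral_le (fun p => ?_) _
  rw [abs_mul, abs_mul]
  calc _ ≤ C * 1 * 1 := by gcongr; exacts [hC p, hf1 _, hg1 _]
    _ = C := by ring

lemma cutDist_nonneg (U W : I → I → ℝ) : 0 ≤ cutDist U W := by
  refine Real.sInf_nonneg ?_
  rintro r ⟨φ, _, rfl⟩
  exact cutNorm_nonneg _

lemma cutDist_le {U W : I → I → ℝ} {φ : I → I}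
    (hφ : MeasurePreserving φ (volume : Measure I) (volume : Measure I)) :
    cutDist U W ≤ cutNorm (fun x y => U x y - W (φ x) (φ y)) := by
  refine csInf_le ⟨0, ?_⟩ ⟨φ, hφ, rfl⟩
  rintro r ⟨φ, _, rfl⟩
  exact cutNorm_nonneg _

noncomputable abbrev lamPi (V : Type*) [Fintype V] : Measure (V → I) := Measure.pi fun _ : V => (volume : Measure I)

lemma mp_update {V : Type*} [Fintype V] [DecidableEq V] (a : V) :
    MeasurePreserving (fun p : (V → I) × I => Function.update p.1 a p.2)
      ((lamPi V).prod volume) (lamPi V) := by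
  have hm : Measurable (fun p : (V → I) × I => Function.update p.1 a p.2) := by
    rw [measurable_pi_iff]
    intro i
    by_cases h : i = a
    · subst h; simpa using measurable_snd
    · simp only [Function.update_of_ne h]; fun_prop
  refine ⟨hm, (Measure.pi_eq fun s hs => ?_).symm⟩
  rw [Measure.map_apply hm (MeasurableSet.univ_pi hs)]
  have : (fun p : (V → I) × I => Function.update p.1 a p.2) ⁻¹' (Set.univ.pi s)
      = (Set.univ.pi (Function.update s a Set.univ)) ×ˢ (s a) := by
    ext ⟨x, t⟩
    simp only [Set.mem_preimage, Set.mem_univ_pi, Set.mem_prod]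
    constructor
    · intro h
      refine ⟨fun i => ?_, by simpa using h a⟩
      by_cases hi : i = a
      · subst hi; simp
      · simpa [Function.update_of_ne hi] using h i
    · rintro ⟨h, h'⟩ i
      by_cases hi : i = a
      · subst hi; simpa using h'
      · simpa [Function.update_of_ne hi] using h i
  rw [this, Measure.prod_prod, Measure.pi_pi]
  rw [← Finset.mul_prod_erase _ _ (Finset.mem_univ a), ← Finset.mul_prod_erase _ _ (Finset.mem_univ a)]
  simp only [Function.update_self, measure_univ, one_mul]
  rw [mul_comm]
  congr 1
  refine Finset.prod_congr rfl fun i hi => ?_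
  rw [Function.update_of_ne (Finset.ne_of_mem_erase hi)]

lemma integral_resample {V : Type*} [Fintype V] [DecidableEq V] (a : V) {Φ : (V → I) → ℝ} (hΦ : BM Φ) :
    ∫ x, Φ x ∂(lamPi V) = ∫ x, ∫ s, Φ (Function.update x a s) ∂(volume : Measure I) ∂(lamPi V) := by
  have h := mp_update (V := V) a
  rw [← h.map_eq, integral_map h.measurable.aemeasurable hΦ.1.aestronglyMeasurable, h.map_eq]
  exact integral_prod _ ((hΦ.comp h.measurable).integrable _)

lemma prod_abs_le_one {ι : Type*} (s : Finset ι) (f : ι → ℝ) (h : ∀ i ∈ s, |f i| ≤ 1) :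
    |∏ i ∈ s, f i| ≤ 1 := by
  rw [Finset.abs_prod]
  exact Finset.prod_le_one (fun _ _ => abs_nonneg _) h

lemma counting_step {m : ℕ} (E : Finset (Fin m × Fin m)) (hE : ∀ p ∈ E, p.1 < p.2)
    {a b : Fin m} (hab : a < b) (hEab : (a, b) ∉ E) (K : Fin m × Fin m → I → I → ℝ)
    (hK : ∀ p, IsGraphon (K p)) {D : I → I → ℝ} (hD : BM (fun p : I × I => D p.1 p.2)) :
    |∫ x, D (x a) (x b) * ∏ p ∈ E, K p (x p.1) (x p.2) ∂(lamPi (Fin m))| ≤ cutNorm D := by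
  have hKm : ∀ p, BM (fun x : Fin m → I => K p (x p.1) (x p.2)) := fun p =>
    (hK p).bm.comp (φ := fun x : Fin m → I => (x p.1, x p.2)) (by fun_prop)
  have hΦ : BM (fun x : Fin m → I => D (x a) (x b) * ∏ p ∈ E, K p (x p.1) (x p.2)) :=
    (hD.comp (φ := fun x : Fin m → I => (x a, x b)) (by fun_prop)).mul
      (BM.prod _ fun p _ => hKm p)
  rw [integral_resample b hΦ]
  have hub : ∀ c : Fin m, Measurable (fun p : (Fin m → I) × I => Function.update p.1 c p.2) :=
    fun c => (mp_update c).measurable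
  rw [integral_resample a (BM.integral (hΦ.comp (hub b)) volume)]
  refine BM.abs_integral_le (fun x => ?_) _
  set f : I → ℝ := fun s => ∏ p ∈ E with ¬ (p.1 = b ∨ p.2 = b),
    K p (Function.update x a s p.1) (Function.update x a s p.2) with hf
  set g : I → ℝ := fun t => ∏ p ∈ E with (p.1 = b ∨ p.2 = b),
    K p (Function.update x b t p.1) (Function.update x b t p.2) with hg
  have hus : ∀ c : Fin m, Measurable (fun s : I => Function.update x c s) := fun c =>
    (hub c).comp measurable_prodMk_left
  have hfm : Measurable f := (BM.prod _ fun p _ => (hKm p).comp (hus a)).1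
  have hgm : Measurable g := (BM.prod _ fun p _ => (hKm p).comp (hus b)).1
  have hf1 : ∀ s, |f s| ≤ 1 := fun s => prod_abs_le_one _ _ fun p _ => (hK p).abs_le _ _
  have hg1 : ∀ s, |g s| ≤ 1 := fun s => prod_abs_le_one _ _ fun p _ => (hK p).abs_le _ _
  have key := le_cutNorm hD hfm hgm hf1 hg1
  have hint : Integrable (fun p : I × I => D p.1 p.2 * f p.1 * g p.2) lam2 :=
    BM.integrable ((hD.mul (BM.comp (f := f) ⟨hfm, 1, hf1⟩ measurable_fst)).mul
      (BM.comp (f := g) ⟨hgm, 1, hg1⟩ measurable_snd)) _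
  rw [integral_prod _ hint] at key
  refine le_of_eq_of_le (congrArg abs (integral_congr_ae (Eventually.of_forall fun s =>
    integral_congr_ae (Eventually.of_forall fun t => ?_)))) key
  simp only
  have hba : b ≠ a := hab.ne'
  rw [Function.update_of_ne hab.ne, Function.update_self, Function.update_self, mul_assoc,
    ← Finset.prod_filter_mul_prod_filter_not E (fun p => p.1 = b ∨ p.2 = b), mul_comm (f s)]
  congr 2
  · refine Finset.prod_congr rfl fun p hp => ?_
    rw [Finset.mem_filter] at hp
    have h1 := hE p hp.1
    have hpa : p.1 ≠ a ∧ p.2 ≠ a := by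
      rcases hp.2 with h | h
      · exact ⟨h ▸ hba, fun h2 => by rw [h, h2] at h1; exact absurd h1 hab.not_gt⟩
      · refine ⟨fun h2 => hEab ?_, h ▸ hba⟩
        rw [← h, ← h2]; exact hp.1
    simp only [Function.update_apply, hpa.1, hpa.2, if_false]
  · refine Finset.prod_congr rfl fun p hp => ?_
    rw [Finset.mem_filter, not_or] at hp
    rw [Function.update_of_ne hp.2.1, Function.update_of_ne hp.2.2]

lemma counting {m : ℕ} (G : SimpleGraph (Fin m)) {U W : I → I → ℝ} (hU : IsGraphon U)
    (hW : IsGraphon W) :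
    |homDensity volume U G - homDensity volume W G| ≤
      (m * m : ℕ) * cutNorm (fun x y => U x y - W x y) := by
  set E := Finset.univ.filter (fun p : Fin m × Fin m => p.1 < p.2 ∧ G.Adj p.1 p.2) with hEdef
  set v : Finset (Fin m × Fin m) → ℝ := fun S =>
    ∫ x, ∏ p ∈ E, (if p ∈ S then U else W) (x p.1) (x p.2) ∂(lamPi (Fin m)) with hv
  have hD : BM (fun p : I × I => U p.1 p.2 - W p.1 p.2) := hU.bm.sub hW.bm
  have hK : ∀ S : Finset (Fin m × Fin m), ∀ p, IsGraphon (if p ∈ S then U else W) := by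
    intro S p; split_ifs <;> assumption
  have main : ∀ S : Finset (Fin m × Fin m), S ⊆ E →
      |v S - v ∅| ≤ S.card * cutNorm (fun x y => U x y - W x y) := by
    intro S
    induction S using Finset.induction_on with
    | empty => simp
    | insert e S he ih =>
      intro hS
      have heE : e ∈ E := hS (by simp)
      have hSE : S ⊆ E := fun p hp => hS (by simp [hp])
      have hlt : e.1 < e.2 := by
        rw [hEdef, Finset.mem_filter] at heE; exact heE.2.1
      have hstep : |v (insert e S) - v S| ≤ cutNorm (fun x y => U x y - W x y) := by
        have h1 := counting_step (E.erase e)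
          (fun p hp => by
            have := Finset.mem_of_mem_erase hp
            rw [hEdef, Finset.mem_filter] at this; exact this.2.1) hlt (by simp)
          (fun p => if p ∈ S then U else W) (hK S) (D := fun x y => U x y - W x y) hD
        have hb : ∀ T : Finset (Fin m × Fin m), Integrable (fun x : Fin m → I =>
            ∏ p ∈ E, (if p ∈ T then U else W) (x p.1) (x p.2)) (lamPi (Fin m)) := fun T =>
          BM.integrable (BM.prod _ fun p _ => (hK T p).bm.comp
            (φ := fun x : Fin m → I => (x p.1, x p.2)) (by fun_prop)) _
        convert h1 using 2
        rw [hv]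
        simp only
        rw [← integral_sub (hb _) (hb _)]
        refine integral_congr_ae (Eventually.of_forall fun x => ?_)
        simp only
        rw [← Finset.mul_prod_erase _ _ heE, ← Finset.mul_prod_erase _ _ heE, sub_mul]
        simp only [Finset.mem_insert_self, if_true, he, if_false]
        congr 2
        refine Finset.prod_congr rfl fun p hp => ?_
        have : p ≠ e := Finset.ne_of_mem_erase hp
        simp [Finset.mem_insert, this]
      have h2 := ih hSE
      rw [Finset.card_insert_of_notMem he]
      push_cast
      calc |v (insert e S) - v ∅| ≤ |v (insert e S) - v S| + |v S - v ∅| := abs_sub_le _ _ _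
        _ ≤ _ := by linarith
  have h := main E le_rfl
  have e1 : v E = homDensity volume U G := by
    rw [hv, homDensity]
    refine integral_congr_ae (Eventually.of_forall fun x => ?_)
    exact Finset.prod_congr rfl fun p hp => by rw [if_pos hp]
  have e2 : v ∅ = homDensity volume W G := by
    rw [hv, homDensity]
    refine integral_congr_ae (Eventually.of_forall fun x => ?_)
    exact Finset.prod_congr rfl fun p hp => by simp
  rw [e1, e2] at h
  refine h.trans (mul_le_mul_of_nonneg_right ?_ (cutNorm_nonneg _))
  have := Finset.card_le_univ E
  simp at this
  exact_mod_cast this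

lemma IsGraphon.comp {W : I → I → ℝ} (hW : IsGraphon W) {φ : I → I} (hφ : Measurable φ) :
    IsGraphon (fun x y => W (φ x) (φ y)) :=
  ⟨hW.1.comp (f := fun p : I × I => (φ p.1, φ p.2)) (by fun_prop), fun _ _ => hW.2.1 _ _, fun _ _ => hW.2.2 _ _⟩

lemma homDensity_comp {W : I → I → ℝ} (hW : IsGraphon W) {φ : I → I}
    (hφ : MeasurePreserving φ (volume : Measure I) volume) {m : ℕ} (G : SimpleGraph (Fin m)) :
    homDensity volume (fun x y => W (φ x) (φ y)) G = homDensity volume W G := by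
  have h : MeasurePreserving (fun (x : Fin m → I) i => φ (x i)) (lamPi (Fin m)) (lamPi (Fin m)) :=
    measurePreserving_pi _ _ fun _ => hφ
  unfold homDensity
  change _ = ∫ x, _ ∂(lamPi (Fin m))
  conv_rhs => rw [← h.map_eq]
  rw [integral_map h.measurable.aemeasurable]
  exact (BM.prod _ fun p _ => hW.bm.comp
            (φ := fun x : Fin m → I => (x p.1, x p.2)) (by fun_prop)).1.aestronglyMeasurable

lemma forward (W : ℕ → I → I → ℝ) (hW : ∀ n, IsGraphon (W n))
    (Wlim : I → I → ℝ) (hWlim : IsGraphon Wlim)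
    (h : Tendsto (fun n => cutDist (W n) Wlim) atTop (𝓝 0)) (m : ℕ) (G : SimpleGraph (Fin m)) :
        Tendsto (fun n => homDensity (volume : Measure I) (W n) G) atTop
          (𝓝 (homDensity (volume : Measure I) Wlim G)) := by
  have key : ∀ n, |homDensity volume (W n) G - homDensity volume Wlim G| ≤
      (m * m : ℕ) * cutDist (W n) Wlim := by
    intro n
    refine le_of_forall_pos_le_add fun ε hε => ?_
    obtain ⟨δ, hδ, hδ'⟩ : ∃ δ > 0, (m * m : ℕ) * δ < ε := by
      refine ⟨ε / ((m * m : ℕ) + 1), by positivity, ?_⟩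
      rw [mul_div_assoc', div_lt_iff₀ (by positivity)]
      nlinarith
    obtain ⟨r, ⟨φ, hφ, rfl⟩, hr⟩ := exists_lt_of_csInf_lt
      (s := {r : ℝ | ∃ φ : I → I, MeasurePreserving φ (volume : Measure I) (volume : Measure I) ∧
        r = cutNorm (fun x y => W n x y - Wlim (φ x) (φ y))})
      ⟨_, id, MeasurePreserving.id _, rfl⟩ (show _ < cutDist (W n) Wlim + δ by
        rw [cutDist]; linarith)
    have h1 := counting G (hW n) (hWlim.comp hφ.measurable)
    rw [homDensity_comp hWlim hφ] at h1
    refine h1.trans ?_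
    have : ((m * m : ℕ) : ℝ) * cutNorm (fun x y => W n x y - Wlim (φ x) (φ y)) ≤
      (m * m : ℕ) * (cutDist (W n) Wlim + δ) := by gcongr
    linarith
  rw [tendsto_iff_norm_sub_tendsto_zero]
  refine squeeze_zero (fun _ => norm_nonneg _) key ?_
  simpa using h.const_mul ((m * m : ℕ) : ℝ)

section abstractOp
variable {V : Type*} [AddCommGroup V] [Module ℝ V] (B : V →ₗ[ℝ] V →ₗ[ℝ] ℝ)
  (hsym : ∀ f g, B f g = B g f) (hpos : ∀ f, 0 ≤ B f f)

lemma form_cs (hsym : ∀ f g, B f g = B g f) (hpos : ∀ f, 0 ≤ B f f) (f g : V) :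
    (B f g) ^ 2 ≤ B f f * B g g := by
  have h : ∀ t : ℝ, 0 ≤ B g g * (t * t) + (2 * B f g) * t + B f f := by
    intro t
    have := hpos (f + t • g)
    simp only [map_add, LinearMap.add_apply, map_smul, LinearMap.smul_apply, smul_eq_mul] at this
    rw [hsym g f] at this
    linarith
  have := discrim_le_zero h
  unfold discrim at this
  linarith

lemma op_bound (hsym : ∀ f g, B f g = B g f) (hpos : ∀ f, 0 ≤ B f f) (T : Module.End ℝ V)
    (hT : ∀ f g, B (T f) g = B f (T g)) (hc : ∀ f, B (T f) (T f) ≤ B f f) (N : ℕ) (g : V) :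
    (B ((T * (1 - T ^ 4) ^ N : Module.End ℝ V) g) ((T * (1 - T ^ 4) ^ N : Module.End ℝ V) g)) ^ 2 ≤ (B g g) ^ 2 / (2 * N + 1) := by
  have hpow : ∀ (S : Module.End ℝ V), (∀ f g, B (S f) g = B f (S g)) → ∀ (n : ℕ) f g,
      B ((S ^ n) f) g = B f ((S ^ n) g) := by
    intro S hS n
    induction n with
    | zero => intro f g; simp
    | succ n ih =>
      intro f g
      conv_lhs => rw [pow_succ, Module.End.mul_apply, ih, hS]
      rw [pow_succ', Module.End.mul_apply]
  set R := T ^ 4 with hR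
  have hRs : ∀ f g, B (R f) g = B f (R g) := hpow T hT 4
  have hQs : ∀ f g, B ((1 - R : Module.End ℝ V) f) g = B f ((1 - R : Module.End ℝ V) g) := by
    intro f g
    simp [LinearMap.sub_apply, hRs]
  have hR2 : ∀ f, B (R f) f = B ((T ^ 2) f) ((T ^ 2) f) := by
    intro f
    rw [← hpow T hT 2, ← Module.End.mul_apply, ← pow_add]
  have hc2 : ∀ f, B ((T ^ 2) f) ((T ^ 2) f) ≤ B f f := by
    intro f
    rw [pow_two, Module.End.mul_apply]
    exact (hc _).trans (hc _)
  have hQpos : ∀ f, 0 ≤ B ((1 - R : Module.End ℝ V) f) f := by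
    intro f
    have h1 := hR2 f
    have h2 := hc2 f
    simp only [LinearMap.sub_apply, Module.End.one_apply, map_sub]
    linarith
  have hQpow : ∀ n f, 0 ≤ B (((1 - R) ^ n : Module.End ℝ V) f) f := by
    intro n f
    rcases Nat.even_or_odd' n with ⟨i, rfl | rfl⟩
    · rw [two_mul, pow_add, Module.End.mul_apply, hpow _ hQs]
      exact hpos _
    · rw [show 2 * i + 1 = i + (1 + i) by ring, pow_add, Module.End.mul_apply, hpow _ hQs, pow_add,
        Module.End.mul_apply, pow_one]
      exact hQpos _
  set c : ℕ → ℝ := fun j => B (((1 - R) ^ j : Module.End ℝ V) g) g with hcdef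
  set b : ℕ → ℝ := fun j => B (R (((1 - R) ^ j : Module.End ℝ V) g)) g with hb
  have hbc : ∀ j, b j = c j - c (j + 1) := by
    intro j
    simp only [hb, hcdef, pow_succ', Module.End.mul_apply, LinearMap.sub_apply, Module.End.one_apply, map_sub]
    ring
  have hcomm : ∀ j, Commute R ((1 - R) ^ j) := fun j =>
    ((Commute.one_right R).sub_right (Commute.refl R)).pow_right j
  have hanti : Antitone b := by
    refine antitone_nat_of_succ_le fun j => ?_
    have h1 : b j - b (j + 1) = B (((1 - R) ^ j : Module.End ℝ V) (R g)) (R g) := by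
      have e : ((1 - R) ^ j : Module.End ℝ V) (R g) = R (((1 - R) ^ j : Module.End ℝ V) g) := by
        rw [← Module.End.mul_apply, ← (hcomm j).eq, Module.End.mul_apply]
      rw [e, ← hRs]
      simp only [hb, pow_succ', Module.End.mul_apply, LinearMap.sub_apply, Module.End.one_apply, map_sub]
      ring
    have := hQpow j (R g)
    linarith
  have hsum : ∀ M, ∑ j ∈ Finset.range (M + 1), b j = c 0 - c (M + 1) := by
    intro M
    simp only [hbc]
    exact Finset.sum_range_sub' c (M + 1)
  have hbM : ∀ M : ℕ, (M + 1) * b M ≤ c 0 := by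
    intro M
    have h1 : ∑ j ∈ Finset.range (M + 1), b M ≤ ∑ j ∈ Finset.range (M + 1), b j :=
      Finset.sum_le_sum fun j hj => hanti (by simp at hj; omega)
    rw [hsum] at h1
    have h2 : 0 ≤ c (M + 1) := hQpow _ _
    simp at h1
    linarith
  set z := ((1 - R) ^ N : Module.End ℝ V) g with hz
  have e1 : B ((T * (1 - R) ^ N : Module.End ℝ V) g) ((T * (1 - R) ^ N : Module.End ℝ V) g) = B ((T ^ 2) z) z := by
    rw [Module.End.mul_apply, ← hT, pow_two, Module.End.mul_apply]
  rw [e1]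
  have e2 : B ((T ^ 2) z) ((T ^ 2) z) = b (2 * N) := by
    rw [← hR2]
    simp only [hb, hz]
    rw [two_mul, pow_add, Module.End.mul_apply, ← hpow _ hQs]
    congr 2
    rw [← Module.End.mul_apply, ← (hcomm N).eq, Module.End.mul_apply]
  have hbpos : ∀ j, 0 ≤ b (2 * j) := by
    intro j
    have : b (2 * j) = B ((T ^ 2) (((1 - R) ^ j : Module.End ℝ V) g)) ((T ^ 2) (((1 - R) ^ j : Module.End ℝ V) g)) := by
      rw [← hR2]
      simp only [hb]
      rw [two_mul, pow_add, Module.End.mul_apply, ← hpow _ hQs]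
      congr 2
      rw [← Module.End.mul_apply, (hcomm j).eq, Module.End.mul_apply]
    rw [this]; exact hpos _
  have hcanti : Antitone c := by
    refine antitone_nat_of_succ_le fun j => ?_
    have h0 : 0 ≤ b j := by
      have h1 : b (2 * j) ≤ b j := hanti (by omega)
      linarith [hbpos j]
    have h1 := hbc j
    linarith
  have e3 : B z z = c (2 * N) := by
    simp only [hcdef, hz]
    rw [two_mul, pow_add, Module.End.mul_apply, ← hpow _ hQs]
  have h4 := form_cs B hsym hpos ((T ^ 2) z) z
  rw [e2, e3] at h4
  have h5 : c (2 * N) ≤ c 0 := hcanti (by omega)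
  have h6 := hbM (2 * N)
  have h7 : c 0 = B g g := by simp [hcdef]
  have h8 : 0 ≤ c 0 := hQpow 0 g
  rw [h7] at h5 h6 h8
  rw [le_div_iff₀ (by positivity)]
  push_cast at h6
  calc (B ((T ^ 2) z) z) ^ 2 * (2 * N + 1) ≤ (b (2 * N) * c (2 * N)) * (2 * N + 1) := by gcongr
    _ ≤ (b (2 * N) * B g g) * (2 * N + 1) := by gcongr; exact hbpos N
    _ = ((2 * N + 1) * b (2 * N)) * B g g := by ring
    _ ≤ B g g * B g g := by gcongr
    _ = _ := by ring

end abstractOp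

/-- the space of bounded measurable functions -/
def bmSub : Submodule ℝ (I → ℝ) where
  carrier := {f | BM f}
  add_mem' := fun hf hg => BM.add hf hg
  zero_mem' := BM.const 0
  smul_mem' := fun c _ hf => (BM.const c).mul hf

abbrev BMK (K : I → I → ℝ) : Prop := BM (fun p : I × I => K p.1 p.2)

lemma BMK.left {K : I → I → ℝ} (hK : BMK K) (x : I) : BM (fun y => K x y) :=
  BM.comp hK (φ := fun y => (x, y)) (by fun_prop)

lemma BMK.right {K : I → I → ℝ} (hK : BMK K) (y : I) : BM (fun x => K x y) :=
  BM.comp hK (φ := fun x => (x, y)) (by fun_prop)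

lemma BMK.op {K : I → I → ℝ} (hK : BMK K) {f : I → ℝ} (hf : BM f) : BM (fun x => ∫ z, K x z * f z) :=
  BM.integral (f := fun x z => K x z * f z) (BM.mul hK (hf.comp measurable_snd)) volume

/-- composition of kernels -/
noncomputable def kc (K K' : I → I → ℝ) : I → I → ℝ := fun x y => ∫ z, K x z * K' z y

lemma BMK.kc {K K' : I → I → ℝ} (hK : BMK K) (hK' : BMK K') : BMK (kc K K') := by
  refine BM.integral (α := I × I) (f := fun p z => K p.1 z * K' z p.2) (BM.mul ?_ ?_) volume
  · exact BM.comp hK (φ := fun p : (I × I) × I => (p.1.1, p.2)) (by fun_prop)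
  · exact BM.comp hK' (φ := fun p : (I × I) × I => (p.2, p.1.2)) (by fun_prop)

noncomputable def opK (K : I → I → ℝ) (hK : BMK K) : Module.End ℝ bmSub where
  toFun f := ⟨fun x => ∫ z, K x z * f.1 z, hK.op f.2⟩
  map_add' f g := by
    ext x
    change ∫ z, K x z * (f.1 z + g.1 z) = (∫ z, K x z * f.1 z) + ∫ z, K x z * g.1 z
    rw [← integral_add (((hK.left x).mul f.2).integrable _) (((hK.left x).mul g.2).integrable _)]
    simp only [mul_add]
  map_smul' c f := by
    ext x
    change ∫ z, K x z * (c * f.1 z) = c * ∫ z, K x z * f.1 z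
    rw [← integral_const_mul]
    congr 1; ext z; ring

lemma opK_apply (K : I → I → ℝ) (hK : BMK K) (f : bmSub) (x : I) :
    (opK K hK f).1 x = ∫ z, K x z * f.1 z := rfl

lemma opK_kc {K K' : I → I → ℝ} (hK : BMK K) (hK' : BMK K') :
    opK (kc K K') (hK.kc hK') = opK K hK * opK K' hK' := by
  ext f x
  rw [Module.End.mul_apply, opK_apply, opK_apply]
  simp only [opK_apply, kc]
  have e1 : ∀ z, (∫ u, K x u * K' u z) * f.1 z = ∫ u, K x u * K' u z * f.1 z := fun z => by
    rw [integral_mul_const]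
  have e2 : ∀ z, K x z * ∫ u, K' z u * f.1 u = ∫ u, K x z * K' z u * f.1 u := fun z => by
    rw [← integral_const_mul]; simp only [mul_assoc]
  simp only [e1, e2]
  refine integral_integral_swap (f := fun z u => K x u * K' u z * f.1 z) (BM.integrable ?_ _)
  refine BM.mul (BM.mul ?_ ?_) ?_
  · exact (hK.left x).comp measurable_snd
  · exact BM.comp hK' (φ := fun p : I × I => (p.2, p.1)) (by fun_prop)
  · exact BM.comp f.2 measurable_fst

lemma opK_sub {K K' : I → I → ℝ} (hK : BMK K) (hK' : BMK K') :
    opK (fun x y => K x y - K' x y) (BM.sub hK hK') = opK K hK - opK K' hK' := by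
  ext f x
  change ∫ z, (K x z - K' x z) * f.1 z = (∫ z, K x z * f.1 z) - ∫ z, K' x z * f.1 z
  rw [← integral_sub (((hK.left x).mul f.2).integrable _) (((hK'.left x).mul f.2).integrable _)]
  simp only [sub_mul]

lemma opK_congr {K K' : I → I → ℝ} (hK : BMK K) (hK' : BMK K') (h : K = K') :
    opK K hK = opK K' hK' := by subst h; rfl

noncomputable def bForm : bmSub →ₗ[ℝ] bmSub →ₗ[ℝ] ℝ :=
  LinearMap.mk₂ ℝ (fun f g => ∫ x, f.1 x * g.1 x)
    (fun f f' g => by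
      change ∫ x, (f.1 x + f'.1 x) * g.1 x = _
      rw [← integral_add ((BM.mul f.2 g.2).integrable _) ((BM.mul f'.2 g.2).integrable _)]
      simp only [add_mul])
    (fun c f g => by
      change ∫ x, (c * f.1 x) * g.1 x = c * _
      rw [← integral_const_mul]; simp only [mul_assoc])
    (fun f g g' => by
      change ∫ x, f.1 x * (g.1 x + g'.1 x) = _
      rw [← integral_add ((BM.mul f.2 g.2).integrable _) ((BM.mul f.2 g'.2).integrable _)]
      simp only [mul_add])
    (fun c f g => by
      change ∫ x, f.1 x * (c * g.1 x) = c * _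
      rw [← integral_const_mul]; congr 1; ext x; ring)

lemma bForm_apply (f g : bmSub) : bForm f g = ∫ x, f.1 x * g.1 x := rfl

lemma bForm_symm (f g : bmSub) : bForm f g = bForm g f := by
  simp only [bForm_apply, mul_comm]

lemma bForm_pos (f : bmSub) : 0 ≤ bForm f f :=
  integral_nonneg fun x => mul_self_nonneg _

lemma bForm_opK {K : I → I → ℝ} (hK : BMK K) (f g : bmSub) :
    bForm f (opK K hK g) = ∫ p : I × I, K p.1 p.2 * f.1 p.1 * g.1 p.2 ∂lam2 := by
  rw [integral_prod]
  · simp only [bForm_apply, opK_apply]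
    congr 1; ext x
    rw [← integral_const_mul]; congr 1; ext z; ring
  · exact BM.integrable (BM.mul (BM.mul hK (BM.comp f.2 measurable_fst))
      (BM.comp g.2 measurable_snd)) _

lemma graphon_op_symm {W : I → I → ℝ} (hW : IsGraphon W) (f g : bmSub) :
    bForm (opK W hW.bm f) g = bForm f (opK W hW.bm g) := by
  rw [bForm_symm, bForm_opK, bForm_opK, ← integral_prod_swap]
  congr 1; ext p
  simp only [Prod.fst_swap, Prod.snd_swap]
  rw [hW.2.1]; ring

lemma sq_integral_le {α : Type*} [MeasurableSpace α] (μ : Measure α) [IsProbabilityMeasure μ]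
    {f : α → ℝ} (hf : BM f) : (∫ x, f x ∂μ) ^ 2 ≤ ∫ x, f x ^ 2 ∂μ := by
  set c := ∫ x, f x ∂μ with hc
  have h : 0 ≤ ∫ x, (f x - c) ^ 2 ∂μ := integral_nonneg fun x => sq_nonneg _
  have e : ∫ x, (f x - c) ^ 2 ∂μ = (∫ x, f x ^ 2 ∂μ) - c ^ 2 := by
    have e1 : ∀ x, (f x - c) ^ 2 = f x ^ 2 - (2 * c) * f x + c ^ 2 := fun x => by ring
    simp only [e1]
    rw [integral_add (((hf.pow 2).sub ((BM.const (2 * c)).mul hf)).integrable _) (integrable_const _),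
      integral_sub ((hf.pow 2).integrable _) (((BM.const (2 * c)).mul hf).integrable _),
      integral_const_mul]
    simp [← hc]; ring
  linarith

lemma graphon_op_contr {W : I → I → ℝ} (hW : IsGraphon W) (f : bmSub) :
    bForm (opK W hW.bm f) (opK W hW.bm f) ≤ bForm f f := by
  simp only [bForm_apply, opK_apply]
  have h1 : ∀ x, (∫ z, W x z * f.1 z) * (∫ z, W x z * f.1 z) ≤ ∫ z, f.1 z * f.1 z := by
    intro x
    rw [← sq]
    refine (sq_integral_le volume (BM.mul (BMK.left hW.bm x) f.2)).trans ?_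
    refine integral_mono (((BM.mul (BMK.left hW.bm x) f.2).pow 2).integrable _)
      ((BM.mul f.2 f.2).integrable _) fun z => ?_
    simp only
    have := hW.2.2 x z
    have h2 : W x z ^ 2 ≤ 1 := by nlinarith [this.1, this.2]
    nlinarith [mul_self_nonneg (f.1 z)]
  have h2 := integral_mono (μ := (volume : Measure I)) ((BM.mul (BMK.op hW.bm f.2) (BMK.op hW.bm f.2)).integrable _)
    (integrable_const (∫ z, f.1 z * f.1 z)) h1
  simpa using h2

/-- smoothed kernels -/
noncomputable def qk (W : I → I → ℝ) : ℕ → I → I → ℝ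
  | 0 => fun _ _ => 0
  | N + 1 => fun x y => qk W N x y +
      (kc (kc W W) W x y - kc (kc W W) (kc (kc W W) (qk W N)) x y)

lemma qk_bm {W : I → I → ℝ} (hW : IsGraphon W) (N : ℕ) : BMK (qk W N) := by
  induction N with
  | zero => exact BM.const 0
  | succ N ih =>
    have hD : BMK (kc W W) := BMK.kc hW.bm hW.bm
    exact BM.add ih (BM.sub (hD.kc hW.bm) (hD.kc (hD.kc ih)))

lemma kc_add {K K1 K2 : I → I → ℝ} (hK : BMK K) (h1 : BMK K1) (h2 : BMK K2) (x y : I) :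
    kc K (fun x y => K1 x y + K2 x y) x y = kc K K1 x y + kc K K2 x y := by
  unfold kc
  rw [← integral_add (((hK.left x).mul (h1.right y)).integrable _) (((hK.left x).mul (h2.right y)).integrable _)]
  simp only [mul_add]

lemma kc_sub {K K1 K2 : I → I → ℝ} (hK : BMK K) (h1 : BMK K1) (h2 : BMK K2) (x y : I) :
    kc K (fun x y => K1 x y - K2 x y) x y = kc K K1 x y - kc K K2 x y := by
  unfold kc
  rw [← integral_sub (((hK.left x).mul (h1.right y)).integrable _) (((hK.left x).mul (h2.right y)).integrable _)]
  simp only [mul_sub]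

lemma Ak_bm {W : I → I → ℝ} (hW : IsGraphon W) (N : ℕ) :
    BMK (fun x y => W x y - kc (kc W W) (qk W N) x y) :=
  BM.sub hW.bm ((BMK.kc hW.bm hW.bm).kc (qk_bm hW N))

lemma ring_step {A : Type*} [Ring A] (T : A) (N : ℕ) :
    T * (1 - T ^ 4) ^ N - T ^ 2 * (T ^ 2 * (T * (1 - T ^ 4) ^ N)) = T * (1 - T ^ 4) ^ (N + 1) := by
  have hcomm : T ^ 2 * (T ^ 2 * (T * (1 - T ^ 4) ^ N)) = T * (1 - T ^ 4) ^ N * T ^ 4 := by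
    have h1 : Commute (T ^ 4) (T * (1 - T ^ 4) ^ N) := by
      refine ((Commute.refl T).pow_left 4).mul_right ?_
      exact ((Commute.one_right _).sub_right (Commute.refl _)).pow_right N
    rw [← mul_assoc, ← pow_add]
    exact h1.eq
  rw [hcomm, pow_succ (1 - T ^ 4) N, ← mul_assoc, mul_sub, mul_one]

lemma op_Ak {W : I → I → ℝ} (hW : IsGraphon W) (N : ℕ) :
    opK (fun x y => W x y - kc (kc W W) (qk W N) x y) (Ak_bm hW N) =
      opK W hW.bm * (1 - opK W hW.bm ^ 4) ^ N := by
  have hD : BMK (kc W W) := BMK.kc hW.bm hW.bm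
  have hT : opK (kc W W) hD = opK W hW.bm ^ 2 := by rw [opK_kc hW.bm hW.bm, pow_two]
  induction N with
  | zero =>
    simp only [pow_zero, mul_one]
    refine opK_congr _ _ ?_
    ext x y
    simp [qk, kc]
  | succ N ih =>
    have e : (fun x y => W x y - kc (kc W W) (qk W (N + 1)) x y) =
        fun x y => (W x y - kc (kc W W) (qk W N) x y) -
          kc (kc W W) (kc (kc W W) (fun x y => W x y - kc (kc W W) (qk W N) x y)) x y := by
      ext x y
      have e1 : kc (kc W W) (fun x y => W x y - kc (kc W W) (qk W N) x y) =
          fun x y => kc (kc W W) W x y - kc (kc W W) (kc (kc W W) (qk W N)) x y := by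
        ext x y
        exact kc_sub hD hW.bm (hD.kc (qk_bm hW N)) x y
      rw [e1]
      have e2 : kc (kc W W) (qk W (N + 1)) x y = kc (kc W W) (qk W N) x y +
          kc (kc W W) (fun x y => kc (kc W W) W x y - kc (kc W W) (kc (kc W W) (qk W N)) x y) x y :=
        kc_add hD (qk_bm hW N) (BM.sub (hD.kc hW.bm) (hD.kc (hD.kc (qk_bm hW N)))) x y
      rw [e2]; ring
    have hA := Ak_bm hW N
    rw [opK_congr (Ak_bm hW (N + 1)) (BM.sub hA (hD.kc (hD.kc hA))) e,
      opK_sub hA (hD.kc (hD.kc hA)), opK_kc hD (hD.kc hA), opK_kc hD hA, ih, hT]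
    exact ring_step (A := Module.End ℝ bmSub) (opK W hW.bm) N

lemma cutNorm_Ak {W : I → I → ℝ} (hW : IsGraphon W) (N : ℕ) :
    cutNorm (fun x y => W x y - kc (kc W W) (qk W N) x y) ^ 4 ≤ 1 / (2 * N + 1) := by
  have h1 : cutNorm (fun x y => W x y - kc (kc W W) (qk W N) x y) ≤
      Real.sqrt (Real.sqrt (1 / (2 * N + 1))) := by
    refine cutNorm_le fun f g hf hg hf1 hg1 => ?_
    have := bForm_opK (Ak_bm hW N) ⟨f, hf, 1, hf1⟩ ⟨g, hg, 1, hg1⟩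
    simp only at this
    rw [← this]
    set F : bmSub := ⟨f, hf, 1, hf1⟩
    set G : bmSub := ⟨g, hg, 1, hg1⟩
    have hn : ∀ (f : I → ℝ) (hf : Measurable f) (hf1 : ∀ x, |f x| ≤ 1),
        bForm ⟨f, hf, 1, hf1⟩ ⟨f, hf, 1, hf1⟩ ≤ 1 := by
      intro f hf hf1
      rw [bForm_apply]
      refine (le_abs_self _).trans (BM.abs_integral_le (fun x => ?_) _)
      simp only
      rw [abs_mul]
      have := hf1 x
      nlinarith [abs_nonneg (f x)]
    have hF : bForm F F ≤ 1 := hn f hf hf1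
    have hG : bForm G G ≤ 1 := hn g hg hg1
    have h2 := form_cs bForm bForm_symm bForm_pos F (opK _ (Ak_bm hW N) G)
    have h3 := op_bound bForm bForm_symm bForm_pos (opK W hW.bm) (graphon_op_symm hW)
      (graphon_op_contr hW) N G
    rw [← op_Ak hW] at h3
    set Z := opK _ (Ak_bm hW N) G
    refine Real.abs_le_sqrt ?_
    refine h2.trans ?_
    have h4 : bForm Z Z ≤ Real.sqrt (1 / (2 * N + 1)) := by
      refine Real.le_sqrt_of_sq_le (h3.trans ?_)
      gcongr
      have := bForm_pos G
      nlinarith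
    have := bForm_pos Z
    nlinarith
  calc _ ≤ (Real.sqrt (Real.sqrt (1 / (2 * N + 1)))) ^ 4 := by
        gcongr; exact cutNorm_nonneg _
    _ = _ := by
        rw [show 4 = 2 * 2 by rfl, pow_mul, Real.sq_sqrt (Real.sqrt_nonneg _), Real.sq_sqrt (by positivity)]

lemma integral_sumPi {L A : Type} [Fintype L] [Fintype A] {Φ : (L ⊕ A → I) → ℝ} (hΦ : BM Φ) :
    ∫ v, Φ v ∂(lamPi (L ⊕ A)) = ∫ x, ∫ u, Φ (Sum.elim x u) ∂(lamPi A) ∂(lamPi L) := by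
  have h := measurePreserving_sumPiEquivProdPi_symm (fun _ : L ⊕ A => (volume : Measure I))
  rw [← h.integral_comp (MeasurableEquiv.measurableEmbedding _) Φ, integral_prod]
  · rfl
  · exact (hΦ.comp (MeasurableEquiv.measurable _)).integrable _

lemma integral_equivPi {V V' : Type} [Fintype V] [Fintype V'] (f : V ≃ V') (Φ : (V' → I) → ℝ) :
    ∫ v, Φ v ∂(lamPi V') = ∫ v, Φ (fun i => v (f.symm i)) ∂(lamPi V) := by
  have h := measurePreserving_piCongrLeft (fun _ : V' => (volume : Measure I)) f
  rw [← h.integral_comp (MeasurableEquiv.measurableEmbedding _) Φ]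
  refine integral_congr_ae (Eventually.of_forall fun v => ?_)
  simp only
  congr 1
  ext i
  obtain ⟨j, rfl⟩ := f.surjective i
  simp only [MeasurableEquiv.coe_piCongrLeft, Equiv.symm_apply_apply]
  rw [Equiv.piCongrLeft_apply_apply (P := fun _ => I)]

lemma integral_unitPi (Φ : (Unit → I) → ℝ) :
    ∫ v, Φ v ∂(lamPi Unit) = ∫ z, Φ (fun _ => z) := by
  have h := measurePreserving_funUnique (volume : Measure I) Unit
  rw [← h.symm.integral_comp (MeasurableEquiv.measurableEmbedding _) Φ]
  rfl

/-- the type of graphons -/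
abbrev GW := {W : I → I → ℝ // IsGraphon W}

noncomputable def repVal {L A ι : Type} [Fintype A] [Fintype ι] (e : ι → A × (L ⊕ A)) (W : GW)
    (x : L → I) : ℝ :=
  ∫ u, ∏ i, W.1 (u (e i).1) (Sum.elim x u (e i).2) ∂(lamPi A)

def symE {L A ι : Type} (e : ι → A × (L ⊕ A)) (i : ι) : Sym2 (L ⊕ A) := s(Sum.inr (e i).1, (e i).2)

def GoodE {L A ι : Type} (e : ι → A × (L ⊕ A)) : Prop :=
  (∀ i, (Sum.inr (e i).1) ≠ (e i).2) ∧ Function.Injective (symE e)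

def IsRep {L : Type} (F : GW → (L → I) → ℝ) : Prop :=
  ∃ (A ι : Type) (_ : Fintype A) (_ : Fintype ι) (e : ι → A × (L ⊕ A)), GoodE e ∧ F = repVal e

lemma rep_bm_aux {L A ι : Type} [Fintype A] [Fintype ι] (e : ι → A × (L ⊕ A)) (W : GW) :
    BM (fun p : (L → I) × (A → I) => ∏ i, W.1 (p.2 (e i).1) (Sum.elim p.1 p.2 (e i).2)) := by
  refine BM.prod _ fun i _ => ?_
  refine BM.comp W.2.bm (φ := fun p : (L → I) × (A → I) => (p.2 (e i).1, Sum.elim p.1 p.2 (e i).2)) ?_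
  refine Measurable.prodMk (by fun_prop) ?_
  rcases (e i).2 with l | a
  · simp only [Sum.elim_inl]; fun_prop
  · simp only [Sum.elim_inr]; fun_prop

lemma rep_bm {L A ι : Type} [Fintype A] [Fintype ι] (e : ι → A × (L ⊕ A)) (W : GW) :
    BM (repVal e W) :=
  BM.integral (f := fun (x : L → I) (u : A → I) => ∏ i, W.1 (u (e i).1) (Sum.elim x u (e i).2))
    (rep_bm_aux e W) (lamPi A)

lemma rep_le {L A ι : Type} [Fintype A] [Fintype ι] (e : ι → A × (L ⊕ A)) (W : GW) (x : L → I) :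
    |repVal e W x| ≤ 1 :=
  BM.abs_integral_le (fun _ => prod_abs_le_one _ _ fun _ _ => W.2.abs_le _ _) _

lemma rep_one {L : Type} : IsRep (1 : GW → (L → I) → ℝ) := by
  refine ⟨Empty, Empty, inferInstance, inferInstance, fun i => i.elim, ⟨fun i => i.elim, fun i => i.elim⟩, ?_⟩
  ext W x
  simp [repVal]

lemma sum_elim_map {L L' A B : Type} (x : L' → I) (f : L → L') (u : B → I) (g : A → B) (v : L ⊕ A) :
    Sum.elim x u (Sum.map f g v) = Sum.elim (fun i => x (f i)) (fun i => u (g i)) v := by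
  cases v <;> rfl

lemma rep_mul {L : Type} {F G : GW → (L → I) → ℝ} (hF : IsRep F) (hG : IsRep G) :
    IsRep (F * G) := by
  obtain ⟨A, ι, _, _, e, he, rfl⟩ := hF
  obtain ⟨A', ι', _, _, e', he', rfl⟩ := hG
  refine ⟨A ⊕ A', ι ⊕ ι', inferInstance, inferInstance,
    Sum.elim (fun i => (Sum.inl (e i).1, Sum.map id Sum.inl (e i).2))
      (fun i => (Sum.inr (e' i).1, Sum.map id Sum.inr (e' i).2)), ⟨?_, ?_⟩, ?_⟩
  · rintro (i | i) h
    · apply he.1 i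
      simp only [Sum.elim_inl] at h
      rcases hv : (e i).2 with l | a <;> simp_all
    · apply he'.1 i
      simp only [Sum.elim_inr] at h
      rcases hv : (e' i).2 with l | a <;> simp_all
  · have h1 : ∀ i, symE (Sum.elim (fun i => (Sum.inl (e i).1, Sum.map id Sum.inl (e i).2))
      (fun i => ((Sum.inr (e' i).1 : A ⊕ A'), (Sum.map id Sum.inr (e' i).2 : L ⊕ (A ⊕ A'))))) (Sum.inl i) =
        Sym2.map (Sum.map id Sum.inl) (symE e i) := fun i => rfl
    have h2 : ∀ i, symE (Sum.elim (fun i => (Sum.inl (e i).1, Sum.map id Sum.inl (e i).2))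
      (fun i => ((Sum.inr (e' i).1 : A ⊕ A'), (Sum.map id Sum.inr (e' i).2 : L ⊕ (A ⊕ A'))))) (Sum.inr i) =
        Sym2.map (Sum.map id Sum.inr) (symE e' i) := fun i => rfl
    have h3 : ∀ i j, Sym2.map (Sum.map id (Sum.inl : A → A ⊕ A')) (symE e i) ≠
        Sym2.map (Sum.map id (Sum.inr : A' → A ⊕ A')) (symE e' j) := by
      intro i j h
      have : (Sum.inr (Sum.inl (e i).1) : L ⊕ (A ⊕ A')) ∈
          Sym2.map (Sum.map id (Sum.inr : A' → A ⊕ A')) (symE e' j) := by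
        rw [← h]; simp [symE]
      simp only [symE, Sym2.map_mk, Sym2.mem_iff] at this
      rcases hv : (e' j).2 with l | a <;> simp_all
    rintro (i | i) (j | j) h
    · rw [h1, h1] at h
      rw [he.2 (Sym2.map.injective (Sum.map_injective.2 ⟨Function.injective_id, Sum.inl_injective⟩) h)]
    · rw [h1, h2] at h
      exact absurd h (h3 _ _)
    · rw [h1, h2] at h
      exact absurd h.symm (h3 _ _)
    · rw [h2, h2] at h
      rw [he'.2 (Sym2.map.injective (Sum.map_injective.2 ⟨Function.injective_id, Sum.inr_injective⟩) h)]
  · ext W x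
    simp only [Pi.mul_apply, repVal, Fintype.prod_sum_type, Sum.elim_inl, Sum.elim_inr, sum_elim_map, id]
    rw [integral_sumPi]
    · simp only [Sum.elim_inl, Sum.elim_inr]
      have : ∀ u : A → I, (∫ u' : A' → I, (∏ i, W.1 (u (e i).1) (Sum.elim x u (e i).2)) *
          ∏ i, W.1 (u' (e' i).1) (Sum.elim x u' (e' i).2) ∂(lamPi A')) =
          (∏ i, W.1 (u (e i).1) (Sum.elim x u (e i).2)) *
          ∫ u' : A' → I, ∏ i, W.1 (u' (e' i).1) (Sum.elim x u' (e' i).2) ∂(lamPi A') := fun u =>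
        integral_const_mul _ _
      change _ = ∫ u : A → I, (∫ u' : A' → I, (∏ i, W.1 (u (e i).1) (Sum.elim x u (e i).2)) *
          ∏ i, W.1 (u' (e' i).1) (Sum.elim x u' (e' i).2) ∂(lamPi A')) ∂(lamPi A)
      simp only [this]
      rw [integral_mul_const]
    · refine BM.mul ?_ ?_
      · exact BM.comp (rep_bm_aux e W) (φ := fun v : A ⊕ A' → I => (x, fun i => v (Sum.inl i))) (by fun_prop)
      · exact BM.comp (rep_bm_aux e' W) (φ := fun v : A ⊕ A' → I => (x, fun i => v (Sum.inr i))) (by fun_prop)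

lemma rep_relabel {L L' : Type} {F : GW → (L → I) → ℝ} (hF : IsRep F) {f : L → L'}
    (hf : Function.Injective f) : IsRep (fun W (x : L' → I) => F W (fun i => x (f i))) := by
  obtain ⟨A, ι, _, _, e, he, rfl⟩ := hF
  have hinj : Function.Injective (Sum.map f (id : A → A)) :=
    Sum.map_injective.2 ⟨hf, Function.injective_id⟩
  refine ⟨A, ι, inferInstance, inferInstance, fun i => ((e i).1, Sum.map f id (e i).2), ⟨?_, ?_⟩, ?_⟩
  · intro i h
    exact he.1 i (hinj h)
  · intro i j h
    have h1 : ∀ i, symE (fun i => ((e i).1, Sum.map f id (e i).2)) i =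
      Sym2.map (Sum.map f id) (symE e i) := fun i => rfl
    rw [h1, h1] at h
    exact he.2 (Sym2.map.injective hinj h)
  · ext W x
    simp only [repVal, sum_elim_map, id]

lemma rep_integrate {L B : Type} [Fintype B] {F : GW → (L ⊕ B → I) → ℝ} (hF : IsRep F) :
    IsRep (fun W (x : L → I) => ∫ y, F W (Sum.elim x y) ∂(lamPi B)) := by
  obtain ⟨A, ι, _, _, e, he, rfl⟩ := hF
  have hinj := (Equiv.sumAssoc L B A).injective
  refine ⟨B ⊕ A, ι, inferInstance, inferInstance,
    fun i => (Sum.inr (e i).1, Equiv.sumAssoc L B A (e i).2), ⟨?_, ?_⟩, ?_⟩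
  · intro i h
    exact he.1 i (hinj h)
  · intro i j h
    have h1 : ∀ i, symE (fun i => ((Sum.inr (e i).1 : B ⊕ A), Equiv.sumAssoc L B A (e i).2)) i =
      Sym2.map (Equiv.sumAssoc L B A) (symE e i) := fun i => rfl
    rw [h1, h1] at h
    exact he.2 (Sym2.map.injective hinj h)
  · ext W x
    simp only [repVal]
    have hs : ∀ (y : B → I) (u : A → I) (v : (L ⊕ B) ⊕ A),
        Sum.elim x (Sum.elim y u) (Equiv.sumAssoc L B A v) = Sum.elim (Sum.elim x y) u v := by
      rintro y u ((l | b) | a) <;> rfl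
    rw [integral_sumPi]
    · simp only [Sum.elim_inr, hs]
    · refine BM.comp (rep_bm_aux (fun i => (Sum.inr (e i).1, Equiv.sumAssoc L B A (e i).2)) W)
        (φ := fun v : B ⊕ A → I => (x, v)) (by fun_prop)

/-- monoid of representable functionals -/
def repM (L : Type) : Submonoid (GW → (L → I) → ℝ) where
  carrier := {F | IsRep F}
  one_mem' := rep_one
  mul_mem' := fun hF hG => rep_mul hF hG

def Alg (L : Type) : Subalgebra ℝ (GW → (L → I) → ℝ) := Algebra.adjoin ℝ (repM L)

lemma alg_induct {L : Type} {P : (GW → (L → I) → ℝ) → Prop}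
    (hrep : ∀ F, IsRep F → P F) (hzero : P 0) (hadd : ∀ F G, P F → P G → P (F + G))
    (hsmul : ∀ (c : ℝ) F, P F → P (c • F)) {F : GW → (L → I) → ℝ} (hF : F ∈ Alg L) : P F := by
  rw [Alg, ← Subalgebra.mem_toSubmodule, Algebra.adjoin_eq_span, Submonoid.closure_eq] at hF
  induction hF using Submodule.span_induction with
  | mem x h => exact hrep x h
  | zero => exact hzero
  | add x y _ _ hx hy => exact hadd x y hx hy
  | smul a x _ hx => exact hsmul a x hx

lemma alg_rep {L : Type} {F : GW → (L → I) → ℝ} (h : IsRep F) : F ∈ Alg L :=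
  Algebra.subset_adjoin h

lemma alg_bm {L : Type} {F : GW → (L → I) → ℝ} (hF : F ∈ Alg L) (W : GW) : BM (F W) := by
  refine alg_induct (P := fun F => BM (F W)) ?_ (BM.const 0) (fun F G hF hG => hF.add hG)
    (fun c F hF => (BM.const c).mul hF) hF
  rintro F ⟨A, ι, _, _, e, he, rfl⟩
  exact rep_bm e W

lemma alg_bdd {L : Type} {F : GW → (L → I) → ℝ} (hF : F ∈ Alg L) :
    ∃ C, 0 < C ∧ ∀ W x, |F W x| ≤ C := by
  refine alg_induct (P := fun F => ∃ C, 0 < C ∧ ∀ W x, |F W x| ≤ C) ?_ ⟨1, one_pos, by simp⟩ ?_ ?_ hF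
  · rintro F ⟨A, ι, _, _, e, he, rfl⟩
    exact ⟨1, one_pos, rep_le e⟩
  · rintro F G ⟨C, h0, hC⟩ ⟨C', h0', hC'⟩
    exact ⟨C + C', by positivity, fun W x => (abs_add_le _ _).trans (add_le_add (hC W x) (hC' W x))⟩
  · rintro c F ⟨C, h0, hC⟩
    refine ⟨(|c| + 1) * C, by positivity, fun W x => ?_⟩
    simp only [Pi.smul_apply, smul_eq_mul, abs_mul]
    gcongr
    · linarith
    · exact hC W x

lemma alg_relabel {L L' : Type} {F : GW → (L → I) → ℝ} (hF : F ∈ Alg L) {f : L → L'}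
    (hf : Function.Injective f) : (fun W (x : L' → I) => F W (fun i => x (f i))) ∈ Alg L' := by
  refine alg_induct (P := fun F => (fun W (x : L' → I) => F W (fun i => x (f i))) ∈ Alg L')
    (fun F h => alg_rep (rep_relabel h hf)) (Alg L').zero_mem (fun F G hF hG => (Alg L').add_mem hF hG)
    (fun c F hF => (Alg L').smul_mem hF c) hF

lemma alg_integrate {L B : Type} [Fintype B] {F : GW → (L ⊕ B → I) → ℝ} (hF : F ∈ Alg (L ⊕ B)) :
    (fun W (x : L → I) => ∫ y, F W (Sum.elim x y) ∂(lamPi B)) ∈ Alg L := by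
  have key : F ∈ Alg (L ⊕ B) ∧ (fun W (x : L → I) => ∫ y, F W (Sum.elim x y) ∂(lamPi B)) ∈ Alg L := by
    have hbm : ∀ F ∈ Alg (L ⊕ B), ∀ (W : GW) (x : L → I), Integrable (fun y => F W (Sum.elim x y)) (lamPi B) := by
      intro F hF W x
      refine ((alg_bm hF W).comp (φ := fun y => Sum.elim x y) ?_).integrable _
      refine measurable_pi_lambda _ ?_
      rintro (l | b)
      · simp
      · simp only [Sum.elim_inr]; fun_prop
    refine alg_induct (P := fun F => F ∈ Alg (L ⊕ B) ∧ (fun W (x : L → I) => ∫ y, F W (Sum.elim x y) ∂(lamPi B)) ∈ Alg L)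
      (fun F h => ⟨alg_rep h, alg_rep (rep_integrate h)⟩) ⟨(Alg _).zero_mem, ?_⟩ ?_ ?_ hF
    · simp only [Pi.zero_apply, integral_zero]; exact (Alg L).zero_mem
    · rintro F G ⟨hF, hF'⟩ ⟨hG, hG'⟩
      refine ⟨(Alg _).add_mem hF hG, ?_⟩
      convert (Alg L).add_mem hF' hG' using 1
      ext W x
      exact integral_add (hbm F hF W x) (hbm G hG W x)
    · rintro c F ⟨hF, hF'⟩
      refine ⟨(Alg _).smul_mem hF c, ?_⟩
      convert (Alg L).smul_mem hF' c using 1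
      ext W x
      exact integral_const_mul _ _
  exact key.2

lemma alg_integrate1 {L : Type} {F : GW → (L ⊕ Unit → I) → ℝ} (hF : F ∈ Alg (L ⊕ Unit)) :
    (fun W (x : L → I) => ∫ z, F W (Sum.elim x (fun _ => z))) ∈ Alg L := by
  have := alg_integrate hF
  simp only [integral_unitPi] at this
  exact this

/-- simple graphs given by edge families are homomorphism densities -/
lemma edges_homDensity {V ι : Type} [Fintype V] [Fintype ι] (a b : ι → V) (hab : ∀ i, a i ≠ b i)
    (hinj : Function.Injective fun i => s(a i, b i)) :
    ∃ (m : ℕ) (G : SimpleGraph (Fin m)), ∀ W : GW,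
      ∫ v, ∏ i, W.1 (v (a i)) (v (b i)) ∂(lamPi V) = homDensity volume W.1 G := by
  set m := Fintype.card V
  let f : V ≃ Fin m := Fintype.equivFin V
  let c : ι → Fin m := fun i => f (a i)
  let d : ι → Fin m := fun i => f (b i)
  have hcd : ∀ i, c i ≠ d i := fun i h => hab i (f.injective h)
  have hinj2 : Function.Injective fun i => s(c i, d i) := by
    intro i j h
    apply hinj
    apply Sym2.map.injective f.injective
    exact h
  refine ⟨m, SimpleGraph.fromEdgeSet (Set.range fun i => s(c i, d i)), fun W => ?_⟩
  rw [integral_equivPi f.symm, homDensity]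
  refine integral_congr_ae (Eventually.of_forall fun v => ?_)
  simp only [Equiv.symm_symm]
  change ∏ i, W.1 (v (c i)) (v (d i)) = _
  refine Finset.prod_bij (fun i _ => (min (c i) (d i), max (c i) (d i))) ?_ ?_ ?_ ?_
  · intro i _
    simp only [Finset.mem_filter, Finset.mem_univ, true_and, SimpleGraph.fromEdgeSet_adj, Set.mem_range]
    refine ⟨min_lt_max.2 (hcd i), ⟨i, ?_⟩, (min_lt_max.2 (hcd i)).ne⟩
    rcases le_total (c i) (d i) with h | h <;> simp [h, Sym2.eq_swap]
  · intro i _ j _ h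
    apply hinj2
    simp only [Prod.mk.injEq] at h
    have : ∀ i, s(c i, d i) = s(min (c i) (d i), max (c i) (d i)) := by
      intro i
      rcases le_total (c i) (d i) with h | h <;> simp [h, Sym2.eq_swap]
    simp only [this, h.1, h.2]
  · rintro ⟨p, q⟩ h
    simp only [Finset.mem_filter, Finset.mem_univ, true_and, SimpleGraph.fromEdgeSet_adj, Set.mem_range] at h
    obtain ⟨h1, ⟨i, hi⟩, h2⟩ := h
    refine ⟨i, Finset.mem_univ _, ?_⟩
    rw [Sym2.eq_iff] at hi
    rcases hi with ⟨rfl, rfl⟩ | ⟨rfl, rfl⟩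
    · simp [h1.le]
    · simp [h1.le]
  · intro i _
    rcases le_total (c i) (d i) with h | h
    · simp [h]
    · simp only [h, min_eq_right, max_eq_left]
      exact W.2.2.1 _ _

/-- convergence of all densities -/
def HomConv (W : ℕ → GW) (Wl : GW) : Prop :=
  ∀ (m : ℕ) (G : SimpleGraph (Fin m)),
        Tendsto (fun n => homDensity (volume : Measure I) (W n).1 G) atTop
          (𝓝 (homDensity (volume : Measure I) Wl.1 G))

lemma alg_tendsto {W : ℕ → GW} {Wl : GW} (h : HomConv W Wl) {L : Type} [Fintype L]
    {F : GW → (L → I) → ℝ} (hF : F ∈ Alg L) :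
    Tendsto (fun n => ∫ x, F (W n) x ∂(lamPi L)) atTop (𝓝 (∫ x, F Wl x ∂(lamPi L))) := by
  have key : F ∈ Alg L ∧ Tendsto (fun n => ∫ x, F (W n) x ∂(lamPi L)) atTop (𝓝 (∫ x, F Wl x ∂(lamPi L))) := by
    refine alg_induct (P := fun F => F ∈ Alg L ∧ Tendsto (fun n => ∫ x, F (W n) x ∂(lamPi L)) atTop
      (𝓝 (∫ x, F Wl x ∂(lamPi L)))) ?_ ⟨(Alg L).zero_mem, by simp⟩ ?_ ?_ hF
    · intro F hF
      refine ⟨alg_rep hF, ?_⟩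
      obtain ⟨A, ι, _, _, e, he, rfl⟩ := hF
      obtain ⟨m, G, hG⟩ := edges_homDensity (V := L ⊕ A) (fun i => Sum.inr (e i).1) (fun i => (e i).2)
        he.1 he.2
      have : ∀ W : GW, ∫ x, repVal e W x ∂(lamPi L) = homDensity volume W.1 G := by
        intro W
        rw [← hG, integral_sumPi]
        · rfl
        · refine BM.prod _ fun i _ => ?_
          exact BM.comp W.2.bm (φ := fun v : L ⊕ A → I => (v (Sum.inr (e i).1), v (e i).2)) (by fun_prop)
      simp only [this]
      exact h m G
    · rintro F G ⟨hF, hF'⟩ ⟨hG, hG'⟩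
      refine ⟨(Alg _).add_mem hF hG, ?_⟩
      have : ∀ W, ∫ x, (F + G) W x ∂(lamPi L) = ∫ x, F W x ∂(lamPi L) + ∫ x, G W x ∂(lamPi L) := fun W =>
        integral_add ((alg_bm hF W).integrable _) ((alg_bm hG W).integrable _)
      simp only [this]
      exact hF'.add hG'
    · rintro c F ⟨hF, hF'⟩
      refine ⟨(Alg _).smul_mem hF c, ?_⟩
      have : ∀ W, ∫ x, (c • F) W x ∂(lamPi L) = c * ∫ x, F W x ∂(lamPi L) := fun W =>
        integral_const_mul _ _
      simp only [this]
      exact hF'.const_mul c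
  exact key.2

def AK (K : GW → I → I → ℝ) : Prop := (fun W (x : Bool → I) => K W (x false) (x true)) ∈ Alg Bool

lemma AK.at {K : GW → I → I → ℝ} (hK : AK K) {L : Type} {l l' : L} (h : l ≠ l') :
    (fun W (x : L → I) => K W (x l) (x l')) ∈ Alg L := by
  have hinj : Function.Injective (fun b : Bool => cond b l' l) := by
    intro b b'
    cases b <;> cases b' <;> simp [h, h.symm]
  exact alg_relabel hK hinj

lemma AK.kc {K K' : GW → I → I → ℝ} (hK : AK K) (hK' : AK K') : AK (fun W => kc (K W) (K' W)) := by
  have h := (Alg (Bool ⊕ Unit)).mul_mem (hK.at (L := Bool ⊕ Unit) (l := Sum.inl false) (l' := Sum.inr ()) (by simp))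
    (hK'.at (L := Bool ⊕ Unit) (l := Sum.inr ()) (l' := Sum.inl true) (by simp))
  exact alg_integrate1 h

lemma AK_D : AK (fun W => _root_.kc W.1 W.1) := by
  refine alg_rep ⟨Unit, Bool, inferInstance, inferInstance, fun i => ((), Sum.inl i), ⟨?_, ?_⟩, ?_⟩
  · intro i; simp
  · intro i j h
    simpa [symE] using h
  · ext W x
    simp only [repVal, Fintype.prod_bool, Sum.elim_inl, integral_unitPi, _root_.kc]
    refine integral_congr_ae (Eventually.of_forall fun z => ?_)
    simp only
    rw [W.2.2.1 (x false) z]; ring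

lemma AK_W3 : AK (fun W => _root_.kc (_root_.kc W.1 W.1) W.1) := by
  refine alg_rep ⟨Unit ⊕ Unit, Fin 3, inferInstance, inferInstance,
    ![(Sum.inr (), Sum.inl false), (Sum.inr (), Sum.inr (Sum.inl ())), (Sum.inl (), Sum.inl true)], ⟨?_, ?_⟩, ?_⟩
  · intro i; fin_cases i <;> simp
  · intro i j h
    fin_cases i <;> fin_cases j <;> simp [symE] at h ⊢
  · ext W x
    simp only [repVal, _root_.kc]
    rw [integral_sumPi, integral_unitPi]
    · refine integral_congr_ae (Eventually.of_forall fun z => ?_)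
      simp only [integral_unitPi, Fin.prod_univ_three]
      rw [← integral_mul_const]
      refine integral_congr_ae (Eventually.of_forall fun z' => ?_)
      simp only [W.2.2.1 (x false) z']
      simp
    · exact BM.comp (rep_bm_aux (L := Bool) (A := Unit ⊕ Unit) ![(Sum.inr (), Sum.inl false), (Sum.inr (), Sum.inr (Sum.inl ())), (Sum.inl (), Sum.inl true)] W)
        (φ := fun v => (x, v)) (by fun_prop)

lemma AK_qk (N : ℕ) : AK (fun W => qk W.1 N) := by
  induction N with
  | zero => exact (Alg Bool).zero_mem
  | succ N ih => exact (Alg Bool).add_mem ih ((Alg Bool).sub_mem AK_W3 (AK_D.kc (AK_D.kc ih)))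

lemma AK_P (N : ℕ) : AK (fun W => _root_.kc (_root_.kc W.1 W.1) (qk W.1 N)) := AK_D.kc (AK_qk N)

lemma AK.bm {K : GW → I → I → ℝ} (hK : AK K) (W : GW) : BMK (K W) :=
  BM.comp (alg_bm hK W) (φ := fun p : I × I => fun b => cond b p.2 p.1) (by
    refine measurable_pi_lambda _ fun b => ?_
    cases b <;> simp <;> fun_prop)

lemma AK.bdd {K : GW → I → I → ℝ} (hK : AK K) : ∃ C, 0 < C ∧ ∀ W x y, |K W x y| ≤ C := by
  obtain ⟨C, h0, hC⟩ := alg_bdd hK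
  exact ⟨C, h0, fun W x y => hC W (fun b => cond b y x)⟩

lemma transfer {W : ℕ → GW} {Wl : GW} (h : HomConv W Wl) {L : Type} [Fintype L]
    (F : ℕ → GW → (L → I) → ℝ) (hF : ∀ i, F i ∈ Alg L) :
    ∀ᵐ xs ∂(lamPi L), ∀ K : ℕ, ∀ δ > 0, ∀ᶠ n in atTop, ∃ x, ∀ i < K, |F i (W n) x - F i Wl xs| < δ := by
  let Ψ : (L → I) → (ℕ → ℝ) := fun x i => F i Wl x
  have hΨ : Measurable Ψ := measurable_pi_lambda _ fun i => (alg_bm (hF i) Wl).1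
  have hsupp : ∀ᵐ y ∂((lamPi L).map Ψ), y ∈ ((lamPi L).map Ψ).support := Measure.support_mem_ae
  filter_upwards [ae_of_ae_map hΨ.aemeasurable hsupp] with xs hxs K δ hδ
  rw [Measure.mem_support_iff_forall] at hxs
  let c : ℕ → ℝ := fun i => F i Wl xs
  let q : GW → (L → I) → ℝ := ∑ i ∈ Finset.range K, (F i - algebraMap ℝ _ (c i)) ^ 2
  have hq : q ∈ Alg L := (Alg L).sum_mem fun i _ => (Alg L).pow_mem ((Alg L).sub_mem (hF i) ((Alg L).algebraMap_mem _)) 2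
  have hqv : ∀ W x, q W x = ∑ i ∈ Finset.range K, (F i W x - c i) ^ 2 := by
    intro W x
    simp only [q, Finset.sum_apply]
    rfl
  obtain ⟨M, hM, hqM⟩ := alg_bdd hq
  let g : GW → (L → I) → ℝ := algebraMap ℝ _ 1 - M⁻¹ • q
  have hg : g ∈ Alg L := (Alg L).sub_mem ((Alg L).algebraMap_mem _) ((Alg L).smul_mem hq _)
  have hgv : ∀ W x, g W x = 1 - M⁻¹ * q W x := fun W x => rfl
  have hg0 : ∀ W x, 0 ≤ g W x := by
    intro W x
    rw [hgv, sub_nonneg, inv_mul_le_iff₀ hM]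
    linarith [(abs_le.1 (hqM W x)).2]
  by_contra hcon
  rw [not_eventually] at hcon
  set a := 1 - M⁻¹ * δ ^ 2
  set b := 1 - M⁻¹ * (δ ^ 2 / 2)
  have hga : ∃ᶠ n in atTop, ∀ x, g (W n) x ≤ a := by
    refine hcon.mono fun n hn x => ?_
    push Not at hn
    obtain ⟨i, hi, hi2⟩ := hn x
    rw [hgv]
    have : δ ^ 2 ≤ q (W n) x := by
      rw [hqv]
      refine le_trans ?_ (Finset.single_le_sum (f := fun i => (F i (W n) x - c i) ^ 2)
        (fun i _ => sq_nonneg _) (Finset.mem_range.2 hi))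
      rw [← sq_abs (F i (W n) x - c i)]
      gcongr
    have : M⁻¹ * δ ^ 2 ≤ M⁻¹ * q (W n) x := by gcongr
    linarith
  have hint : ∀ m : ℕ, ∫ x, (g Wl x) ^ m ∂(lamPi L) ≤ a ^ m := by
    intro m
    have ht := alg_tendsto h ((Alg L).pow_mem hg m)
    refine le_of_tendsto_of_frequently ht (hga.mono fun n hn => ?_)
    have : ∫ x, (g ^ m) (W n) x ∂(lamPi L) ≤ ∫ x, a ^ m ∂(lamPi L) := by
      refine integral_mono ((alg_bm ((Alg L).pow_mem hg m) (W n)).integrable _) (integrable_const _) fun x => ?_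
      exact pow_le_pow_left₀ (hg0 _ _) (hn x) m
    simpa using this
  have ha0 : 0 ≤ a := by
    obtain ⟨n, hn⟩ := hga.exists
    exact (hg0 (W n) (fun _ => 0)).trans (hn _)
  have hab : a < b := by
    have : 0 < M⁻¹ * δ ^ 2 := by positivity
    simp only [a, b]; linarith
  have hb0 : 0 < b := ha0.trans_lt hab
  let S : Set (L → I) := {x | q Wl x < δ ^ 2 / 2}
  have hSm : MeasurableSet S := measurableSet_lt (alg_bm hq Wl).1 measurable_const
  have hS : 0 < lamPi L S := by
    let U : Set (ℕ → ℝ) := {y | ∑ i ∈ Finset.range K, (y i - c i) ^ 2 < δ ^ 2 / 2}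
    have hU : IsOpen U := isOpen_lt (by fun_prop) continuous_const
    have := hxs U (hU.mem_nhds (by simp [U, Ψ, c]; positivity))
    rw [Measure.map_apply hΨ hU.measurableSet] at this
    convert this using 2
    ext x
    simp only [S, U, Set.mem_ofPred_eq, Set.mem_preimage, hqv, Ψ]
  set s := (lamPi L).real S
  have hs : 0 < s := ENNReal.toReal_pos hS.ne' (measure_ne_top _ _)
  have hlow : ∀ m : ℕ, b ^ m * s ≤ ∫ x, (g Wl x) ^ m ∂(lamPi L) := by
    intro m
    calc b ^ m * s = ∫ x, S.indicator (fun _ => b ^ m) x ∂(lamPi L) := by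
          rw [integral_indicator_const _ hSm]; simp [s, mul_comm]
      _ ≤ _ := by
          refine integral_mono ((integrable_const _).indicator hSm)
            ((alg_bm ((Alg L).pow_mem hg m) Wl).integrable _) fun x => ?_
          by_cases hx : x ∈ S
          · simp only [Set.indicator_of_mem hx]
            refine pow_le_pow_left₀ hb0.le ?_ m
            rw [hgv]
            have : M⁻¹ * q Wl x ≤ M⁻¹ * (δ ^ 2 / 2) := by
              gcongr; exact le_of_lt hx
            change 1 - M⁻¹ * (δ ^ 2 / 2) ≤ _
            linarith
          · simp only [Set.indicator_of_notMem hx]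
            exact pow_nonneg (hg0 _ _) _
  have hfin : ∀ m : ℕ, s ≤ (a / b) ^ m := by
    intro m
    rw [div_pow, le_div_iff₀ (by positivity), mul_comm]
    exact (hlow m).trans (hint m)
  have hlim : Tendsto (fun m : ℕ => (a / b) ^ m) atTop (𝓝 0) :=
    tendsto_pow_atTop_nhds_zero_of_lt_one (by positivity) ((div_lt_one hb0).2 hab)
  have := ge_of_tendsto' hlim hfin
  linarith

lemma diagonal {P : ℕ → ℕ → Prop} (h0 : ∀ n, P 0 n) (h : ∀ K, ∀ᶠ n in atTop, P K n) :
    ∃ κ : ℕ → ℕ, Tendsto κ atTop atTop ∧ ∀ n, P (κ n) n := by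
  refine ⟨fun n => Nat.findGreatest (fun K => P K n) n, ?_, fun n => ?_⟩
  · rw [tendsto_atTop]
    intro K
    filter_upwards [h K, eventually_ge_atTop K] with n hn hK
    exact Nat.le_findGreatest hK hn
  · exact Nat.findGreatest_spec (P := fun K => P K n) (Nat.zero_le n) (h0 n)

lemma transfer_seq {W : ℕ → GW} {Wl : GW} (h : HomConv W Wl) {L : Type} [Fintype L]
    (F : ℕ → GW → (L → I) → ℝ) (hF : ∀ i, F i ∈ Alg L) :
    ∀ᵐ xs ∂(lamPi L), ∃ x : ℕ → L → I, ∀ i,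
      Tendsto (fun n => F i (W n) (x n)) atTop (𝓝 (F i Wl xs)) := by
  filter_upwards [transfer h F hF] with xs hxs
  obtain ⟨κ, hκ, hP⟩ := diagonal
    (P := fun K n => ∃ x, ∀ i < K, |F i (W n) x - F i Wl xs| < 1 / ((K : ℝ) + 1))
    (fun n => ⟨xs, by simp⟩) (fun K => hxs K _ (by positivity))
  choose x hx using hP
  refine ⟨x, fun i => ?_⟩
  rw [tendsto_iff_dist_tendsto_zero]
  have hz : Tendsto (fun n => 1 / ((κ n : ℝ) + 1)) atTop (𝓝 0) :=
    tendsto_one_div_add_atTop_nhds_zero_nat.comp hκ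
  refine squeeze_zero' (Eventually.of_forall fun n => dist_nonneg) ?_ hz
  filter_upwards [hκ.eventually_gt_atTop i] with n hn
  exact (hx n i hn).le

lemma variance_pi_le {k : ℕ} (hk : 0 < k) {h : I → ℝ} (hh : BM h) {C : ℝ} (hC : ∀ x, |h x| ≤ C) :
    ∫ x : Fin k → I, ((∫ z, h z) - (1 / (k : ℝ)) * ∑ i, h (x i)) ^ 2 ∂(lamPi (Fin k)) ≤ C ^ 2 / k := by
  have hk' : (0 : ℝ) < k := by exact_mod_cast hk
  let g : I → ℝ := fun z => (1 / (k : ℝ)) * h z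
  have hg : BM g := (BM.const _).mul hh
  have hgL : MemLp g 2 (volume : Measure I) := by
    obtain ⟨hm, B, hB⟩ := hg
    exact MemLp.of_bound hm.aestronglyMeasurable B (Eventually.of_forall hB)
  have hv := ProbabilityTheory.variance_sum_pi (ι := Fin k) (μ := fun _ => (volume : Measure I))
    (X := fun _ => g) (fun _ => hgL)
  have hbm : BM (fun x : Fin k → I => ∑ i, g (x i)) :=
    BM.sum _ fun i _ => hg.comp (measurable_pi_apply i)
  have hmean : ∫ x, ∑ i, g (x i) ∂(lamPi (Fin k)) = ∫ z, h z := by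
    rw [integral_finsetSum _ fun i _ => (hg.comp (measurable_pi_apply i)).integrable _]
    have : ∀ i : Fin k, ∫ x, g (x i) ∂(lamPi (Fin k)) = ∫ z, g z := fun i => by
      have mp := measurePreserving_eval (fun _ : Fin k => (volume : Measure I)) i
      have := integral_map (μ := lamPi (Fin k)) (φ := Function.eval i) (f := g) mp.measurable.aemeasurable
        (by rw [mp.map_eq]; exact hg.1.aestronglyMeasurable)
      rw [mp.map_eq] at this
      exact this.symm
    simp only [this, g, integral_const_mul]
    simp
    field_simp
  have e1 : (∑ i, fun (ω : Fin k → I) => g (ω i)) = fun x => ∑ i, g (x i) := by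
    ext x; simp
  rw [e1, ProbabilityTheory.variance_eq_integral hbm.1.aemeasurable, hmean] at hv
  have e2 : ∫ x : Fin k → I, ((∫ z, h z) - (1 / (k : ℝ)) * ∑ i, h (x i)) ^ 2 ∂(lamPi (Fin k)) =
      ∫ x : Fin k → I, (∑ i, g (x i) - ∫ z, h z) ^ 2 ∂(lamPi (Fin k)) := by
    refine integral_congr_ae (Eventually.of_forall fun x => ?_)
    simp only [g, ← Finset.mul_sum]
    ring
  rw [e2, hv]
  have h3 : ProbabilityTheory.variance g volume ≤ C ^ 2 / k ^ 2 := by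
    refine (ProbabilityTheory.variance_le_expectation_sq hg.1.aestronglyMeasurable).trans ?_
    refine (le_abs_self _).trans (BM.abs_integral_le (fun z => ?_) _)
    simp only [Pi.pow_apply, g, abs_pow, abs_mul]
    rw [mul_pow, abs_of_pos (by positivity : 0 < 1 / (k : ℝ))]
    calc (1 / (k : ℝ)) ^ 2 * |h z| ^ 2 ≤ (1 / (k : ℝ)) ^ 2 * C ^ 2 := by
          gcongr; exact hC z
      _ = _ := by ring
  simp only [Finset.sum_const, Finset.card_univ, Fintype.card_fin, nsmul_eq_mul]
  calc (k : ℝ) * ProbabilityTheory.variance g volume ≤ k * (C ^ 2 / k ^ 2) := by gcongr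
    _ = _ := by field_simp

noncomputable def feat (N k : ℕ) (W : GW) (x : Fin k → I) : (Fin k ⊕ Fin k) → I → ℝ
  | Sum.inl i => fun y => kc W.1 W.1 y (x i)
  | Sum.inr i => fun y => qk W.1 N (x i) y

noncomputable def approxK (N k : ℕ) (W : GW) (x : Fin k → I) (y y' : I) : ℝ :=
  (1 / (k : ℝ)) * ∑ i, feat N k W x (Sum.inl i) y * feat N k W x (Sum.inr i) y'

noncomputable def errK (N k : ℕ) (W : GW) (x : Fin k → I) : ℝ :=
  ∫ p : I × I, (kc (kc W.1 W.1) (qk W.1 N) p.1 p.2 - approxK N k W x p.1 p.2) ^ 2 ∂lam2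

noncomputable def momK (N k : ℕ) (α : (Fin k ⊕ Fin k) → ℕ) (W : GW) (x : Fin k → I) : ℝ :=
  ∫ y, ∏ j, feat N k W x j y ^ α j

lemma feat_alg (N k : ℕ) {L : Type} (f : Fin k → L) (l : L) (hl : ∀ i, f i ≠ l) (j : Fin k ⊕ Fin k) :
    (fun W (x : L → I) => feat N k W (fun i => x (f i)) j (x l)) ∈ Alg L := by
  rcases j with i | i
  · exact AK_D.at (hl i).symm
  · exact (AK_qk N).at (hl i)

lemma feat_bm (N k : ℕ) (W : GW) (x : Fin k → I) (j : Fin k ⊕ Fin k) : BM (feat N k W x j) := by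
  rcases j with i | i
  · exact (AK_D.bm W).right (x i)
  · exact ((AK_qk N).bm W).left (x i)

lemma feat_bdd (N : ℕ) : ∃ C, 0 < C ∧ ∀ k W x j y, |feat N k W x j y| ≤ C := by
  obtain ⟨C, h0, hC⟩ := AK_D.bdd
  obtain ⟨C', h0', hC'⟩ := (AK_qk N).bdd
  refine ⟨max C C', lt_max_of_lt_left h0, ?_⟩
  rintro k W x (i | i) y
  · exact (hC _ _ _).trans (le_max_left _ _)
  · exact (hC' _ _ _).trans (le_max_right _ _)

lemma approx_bm (N k : ℕ) (W : GW) (x : Fin k → I) : BMK (approxK N k W x) :=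
  (BM.const _).mul (BM.sum _ fun i _ => ((feat_bm N k W x _).comp measurable_fst).mul
    ((feat_bm N k W x _).comp measurable_snd))

lemma momK_alg (N k : ℕ) (α : (Fin k ⊕ Fin k) → ℕ) : momK N k α ∈ Alg (Fin k) := by
  have h : (∏ j, (fun W (x : Fin k ⊕ Unit → I) => feat N k W (fun i => x (Sum.inl i)) j (x (Sum.inr ()))) ^ α j)
      ∈ Alg (Fin k ⊕ Unit) :=
    (Alg _).prod_mem fun j _ => (Alg _).pow_mem (feat_alg N k _ _ (by simp) j) _
  convert alg_integrate1 h using 1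
  ext W x
  simp only [momK, Finset.prod_apply, Pi.pow_apply, Sum.elim_inl, Sum.elim_inr]

lemma errK_alg (N k : ℕ) : errK N k ∈ Alg (Fin k) := by
  have hP := (AK_P N).at (L := (Fin k ⊕ Unit) ⊕ Unit) (l := Sum.inl (Sum.inr ())) (l' := Sum.inr ()) (by simp)
  have h1 := (Alg _).sum_mem (t := Finset.univ) fun (i : Fin k) _ => (Alg _).mul_mem
    (feat_alg N k (L := (Fin k ⊕ Unit) ⊕ Unit) (fun i => Sum.inl (Sum.inl i)) (Sum.inl (Sum.inr ())) (by simp) (Sum.inl i))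
    (feat_alg N k (L := (Fin k ⊕ Unit) ⊕ Unit) (fun i => Sum.inl (Sum.inl i)) (Sum.inr ()) (by simp) (Sum.inr i))
  have h2 := (Alg _).pow_mem ((Alg _).sub_mem hP ((Alg _).smul_mem h1 (1 / (k : ℝ)))) 2
  convert alg_integrate1 (alg_integrate1 h2) using 1
  ext W x
  rw [errK, integral_prod]
  · refine integral_congr_ae (Eventually.of_forall fun y => ?_)
    refine integral_congr_ae (Eventually.of_forall fun y' => ?_)
    simp [approxK]
  · exact (BM.pow (BM.sub ((AK_P N).bm W) (approx_bm N k W x)) 2).integrable _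

lemma feat_joint_bm (N k : ℕ) (W : GW) (j : Fin k ⊕ Fin k) :
    BM (fun p : (Fin k → I) × I => feat N k W p.1 j p.2) := by
  rcases j with i | i
  · exact BM.comp (AK_D.bm W) (φ := fun p : (Fin k → I) × I => (p.2, p.1 i)) (by fun_prop)
  · exact BM.comp ((AK_qk N).bm W) (φ := fun p : (Fin k → I) × I => (p.1 i, p.2)) (by fun_prop)

lemma errK_mean (N k : ℕ) (hk : 0 < k) (W : GW) {C : ℝ} (hC : ∀ k W x j y, |feat N k W x j y| ≤ C) :
    ∫ x, errK N k W x ∂(lamPi (Fin k)) ≤ (C * C) ^ 2 / k := by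
  have hC0 : 0 ≤ C := (abs_nonneg _).trans (hC 1 W (fun _ => 0) (Sum.inl 0) 0)
  have hbm : BM (fun p : (Fin k → I) × (I × I) =>
      (kc (kc W.1 W.1) (qk W.1 N) p.2.1 p.2.2 - approxK N k W p.1 p.2.1 p.2.2) ^ 2) := by
    refine BM.pow (BM.sub (BM.comp ((AK_P N).bm W) measurable_snd) ?_) 2
    refine (BM.const _).mul (BM.sum _ fun i _ => BM.mul ?_ ?_)
    · exact BM.comp (feat_joint_bm N k W (Sum.inl i)) (φ := fun p : (Fin k → I) × (I × I) => (p.1, p.2.1)) (by fun_prop)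
    · exact BM.comp (feat_joint_bm N k W (Sum.inr i)) (φ := fun p : (Fin k → I) × (I × I) => (p.1, p.2.2)) (by fun_prop)
  have hswap := integral_integral_swap (μ := lamPi (Fin k)) (ν := lam2)
    (f := fun x p => (kc (kc W.1 W.1) (qk W.1 N) p.1 p.2 - approxK N k W x p.1 p.2) ^ 2) (hbm.integrable _)
  simp only [errK]
  rw [hswap]
  refine (le_abs_self _).trans (BM.abs_integral_le (fun p => ?_) _)
  rw [abs_of_nonneg (integral_nonneg fun x => sq_nonneg _)]
  refine variance_pi_le hk (h := fun z => kc W.1 W.1 p.1 z * qk W.1 N z p.2)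
    (((AK_D.bm W).left p.1).mul (((AK_qk N).bm W).right p.2)) (C := C * C) fun z => ?_
  rw [abs_mul]
  gcongr
  · exact hC 1 W (fun _ => z) (Sum.inl 0) p.1
  · exact hC 1 W (fun _ => z) (Sum.inr 0) p.2

lemma sample {W : ℕ → GW} {Wl : GW} (h : HomConv W Wl) (N k : ℕ) (hk : 0 < k) {C : ℝ}
    (hC : ∀ k W x j y, |feat N k W x j y| ≤ C) :
    ∃ (xs : Fin k → I) (x : ℕ → Fin k → I), errK N k Wl xs ≤ (C * C) ^ 2 / k ∧
      Tendsto (fun n => errK N k (W n) (x n)) atTop (𝓝 (errK N k Wl xs)) ∧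
      ∀ α, Tendsto (fun n => momK N k α (W n) (x n)) atTop (𝓝 (momK N k α Wl xs)) := by
  obtain ⟨en, hen⟩ := exists_surjective_nat (Option ((Fin k ⊕ Fin k) → ℕ))
  let F : Option ((Fin k ⊕ Fin k) → ℕ) → GW → (Fin k → I) → ℝ := fun o =>
    o.elim (errK N k) (momK N k)
  have hF : ∀ o, F o ∈ Alg (Fin k) := by
    rintro (_ | α)
    · exact errK_alg N k
    · exact momK_alg N k α
  have h1 := transfer_seq h (fun i => F (en i)) (fun i => hF _)
  have h2 := measure_le_integral_pos ((alg_bm (errK_alg N k) Wl).integrable (lamPi (Fin k)))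
  have h3 : ∃ᵐ xs ∂(lamPi (Fin k)), errK N k Wl xs ≤ ∫ a, errK N k Wl a ∂(lamPi (Fin k)) := by
    rw [frequently_ae_iff]
    exact h2.ne'
  obtain ⟨xs, h4, x, h5⟩ := (h3.and_eventually h1).exists
  have h6 : ∀ o, Tendsto (fun n => F o (W n) (x n)) atTop (𝓝 (F o Wl xs)) := by
    intro o
    obtain ⟨i, rfl⟩ := hen o
    exact h5 i
  exact ⟨xs, x, h4.trans (errK_mean N k hk Wl hC), h6 none, fun α => h6 (some α)⟩

lemma cdf_lip {A : Set I} {y y' : I} (h : y ≤ y') :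
    (volume : Measure I).real (A ∩ Set.Iic y') ≤ (volume : Measure I).real (A ∩ Set.Iic y) + (y' - y : ℝ) := by
  have h1 : A ∩ Set.Iic y' ⊆ (A ∩ Set.Iic y) ∪ Set.Ioc y y' := by
    rintro z ⟨hz, hz'⟩
    by_cases hy : z ≤ y
    · exact Or.inl ⟨hz, hy⟩
    · exact Or.inr ⟨not_le.1 hy, hz'⟩
  refine (measureReal_mono h1).trans ((measureReal_union_le _ _).trans ?_)
  gcongr
  rw [Measure.real, unitInterval.volume_Ioc, ENNReal.toReal_ofReal]
  exact sub_nonneg.2 h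

lemma cdf_cont (A : Set I) : Continuous (fun y : I => (volume : Measure I).real (A ∩ Set.Iic y)) := by
  have : LipschitzWith 1 (fun y : I => (volume : Measure I).real (A ∩ Set.Iic y)) := by
    refine LipschitzWith.of_le_add fun y y' => ?_
    rcases le_total y y' with h | h
    · refine (measureReal_mono (Set.inter_subset_inter_right _ (Set.Iic_subset_Iic.2 h))).trans ?_
      linarith [dist_nonneg (x := y) (y := y')]
    · refine (cdf_lip h).trans ?_
      gcongr
      exact le_abs_self _
  exact this.continuous

lemma cdf_zero (A : Set I) : (volume : Measure I).real (A ∩ Set.Iic 0) = 0 := by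
  have h : (volume : Measure I).real (A ∩ Set.Iic 0) ≤ (volume : Measure I).real (Set.Iic (0 : I)) :=
    measureReal_mono Set.inter_subset_right
  have h2 : (volume : Measure I).real (Set.Iic (0 : I)) = 0 := by
    rw [Measure.real, unitInterval.volume_Iic]; simp
  exact le_antisymm (h.trans h2.le) measureReal_nonneg

lemma cdf_one (A : Set I) : (volume : Measure I).real (A ∩ Set.Iic 1) = (volume : Measure I).real A := by
  congr 1
  ext z
  exact ⟨fun h => h.1, fun h => ⟨h, (show (z : ℝ) ≤ 1 from z.2.2)⟩⟩

lemma cdf_ivt (A : Set I) {t : ℝ} (h0 : 0 ≤ t) (h1 : t ≤ (volume : Measure I).real A) :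
    ∃ y : I, (volume : Measure I).real (A ∩ Set.Iic y) = t := by
  have := intermediate_value_univ (0 : I) 1 (cdf_cont A)
  rw [cdf_zero, cdf_one] at this
  exact this ⟨h0, h1⟩

lemma exists_sub_measure {A : Set I} (hA : MeasurableSet A) {t : ENNReal} (h1 : t ≤ (volume : Measure I) A) :
    ∃ B ⊆ A, MeasurableSet B ∧ (volume : Measure I) B = t := by
  have ht : t ≠ ⊤ := ne_top_of_le_ne_top (measure_ne_top _ _) h1
  obtain ⟨y, hy⟩ := cdf_ivt A (t := t.toReal) ENNReal.toReal_nonneg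
    (ENNReal.toReal_mono (measure_ne_top _ _) h1)
  refine ⟨A ∩ Set.Iic y, Set.inter_subset_left, hA.inter measurableSet_Iic, ?_⟩
  rw [← ENNReal.ofReal_toReal ht, ← hy, Measure.real, ENNReal.ofReal_toReal (measure_ne_top _ _)]

lemma transport {A : Set I} (hA : MeasurableSet A) (τ : Measure I) (hτ : τ Set.univ = (volume : Measure I) A) :
    ∃ T : I → I, Measurable T ∧ ((volume : Measure I).restrict A).map T = τ := by
  by_cases h0 : (volume : Measure I) A = 0
  · refine ⟨id, measurable_id, ?_⟩
    rw [Measure.map_id, Measure.restrict_eq_zero.2 h0]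
    rw [h0, Measure.measure_univ_eq_zero] at hτ
    exact hτ.symm
  set m := (volume : Measure I) A with hm
  have hmt : m ≠ ⊤ := measure_ne_top _ _
  have hm0 : 0 < (volume : Measure I).real A := ENNReal.toReal_pos h0 hmt
  let F : I → I := fun y => ⟨(volume : Measure I).real (A ∩ Set.Iic y) / (volume : Measure I).real A,
    div_nonneg measureReal_nonneg measureReal_nonneg,
    (div_le_one hm0).2 (measureReal_mono Set.inter_subset_left)⟩
  have hF : Measurable F := ((cdf_cont A).div_const _).subtype_mk _ |>.measurable
  have hmapF : ((volume : Measure I).restrict A).map F = m • (volume : Measure I) := by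
    haveI : IsFiniteMeasure (((volume : Measure I).restrict A).map F) := inferInstance
    refine Measure.ext_of_Iic _ _ fun t => ?_
    rw [Measure.map_apply hF measurableSet_Iic, Measure.restrict_apply (hF measurableSet_Iic)]
    rw [Measure.smul_apply, unitInterval.volume_Iic, smul_eq_mul]
    -- the sup of the sublevel set
    have hcl : IsClosed {y : I | (volume : Measure I).real (A ∩ Set.Iic y) ≤ t * (volume : Measure I).real A} :=
      isClosed_le (cdf_cont A) continuous_const
    obtain ⟨s, hs, hmax⟩ := hcl.isCompact.exists_isGreatest ⟨0, by
      simp only [Set.mem_ofPred_eq]; rw [cdf_zero]; exact mul_nonneg t.2.1 measureReal_nonneg⟩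
    have hst : (volume : Measure I).real (A ∩ Set.Iic s) = t * (volume : Measure I).real A := by
      refine le_antisymm hs ?_
      obtain ⟨y, hy⟩ := cdf_ivt A (t := t * (volume : Measure I).real A) (mul_nonneg t.2.1 measureReal_nonneg)
        (mul_le_of_le_one_left measureReal_nonneg t.2.2)
      rw [← hy]
      exact measureReal_mono (Set.inter_subset_inter_right _ (Set.Iic_subset_Iic.2 (hmax hy.le)))
    have e : F ⁻¹' Set.Iic t ∩ A = A ∩ Set.Iic s := by
      ext y
      have : F y ≤ t ↔ y ≤ s := by
        rw [← Subtype.coe_le_coe]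
        simp only [F]
        rw [div_le_iff₀ hm0]
        constructor
        · intro h; exact hmax h
        · intro h
          exact (measureReal_mono (Set.inter_subset_inter_right _ (Set.Iic_subset_Iic.2 h))).trans hs
      simp only [Set.mem_inter_iff, Set.mem_preimage, Set.mem_Iic, this]
      tauto
    rw [e, ← ENNReal.ofReal_toReal (measure_ne_top volume (A ∩ Set.Iic s))]
    change ENNReal.ofReal ((volume : Measure I).real (A ∩ Set.Iic s)) = _
    rw [hst, ENNReal.ofReal_mul t.2.1, mul_comm, Measure.real, ENNReal.ofReal_toReal hmt]
  haveI : IsProbabilityMeasure (m⁻¹ • τ) := ⟨by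
    rw [Measure.smul_apply, hτ, smul_eq_mul, ENNReal.inv_mul_cancel h0 hmt]⟩
  obtain ⟨f, hf, hfm⟩ := MeasureTheory.Measure.exists_measurable_map_eq (m⁻¹ • τ)
  refine ⟨f ∘ F, hf.comp hF, ?_⟩
  rw [← Measure.map_map hf hF, hmapF, Measure.map_smul, hfm, smul_smul, ENNReal.mul_inv_cancel h0 hmt, one_smul]

lemma sum_restrict_fibers {T : Type*} [Fintype T] {a : I → T} (ha : ∀ s, MeasurableSet (a ⁻¹' {s})) :
    ∑ s, (volume : Measure I).restrict (a ⁻¹' {s}) = volume := by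
  ext B hB
  simp only [Measure.finsetSum_apply, Measure.restrict_apply hB]
  rw [← measure_biUnion_finset]
  · congr 1; ext y; simp
  · intro s _ t _ hst
    refine Set.disjoint_left.2 ?_
    rintro y ⟨_, h1⟩ ⟨_, h2⟩
    exact hst (h1.symm.trans h2)
  · intro s _
    exact hB.inter (ha s)

lemma glue {T : Type*} [Fintype T] {a b : I → T} (ha : ∀ s, MeasurableSet (a ⁻¹' {s}))
    (hb : ∀ s, MeasurableSet (b ⁻¹' {s}))
    (hab : ∀ s, (volume : Measure I) (a ⁻¹' {s}) = (volume : Measure I) (b ⁻¹' {s})) :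
    ∃ φ : I → I, MeasurePreserving φ (volume : Measure I) (volume : Measure I) ∧
      ∀ᵐ y ∂(volume : Measure I), b (φ y) = a y := by
  have h1 : ∀ s, ∃ T : I → I, Measurable T ∧
      ((volume : Measure I).restrict (a ⁻¹' {s})).map T = (volume : Measure I).restrict (b ⁻¹' {s}) := fun s =>
    transport (ha s) _ (by simp [hab s])
  choose T hT hTm using h1
  let φ : I → I := fun y => T (a y) y
  have hpre : ∀ (s : _) (B : Set I), φ ⁻¹' B ∩ a ⁻¹' {s} = T s ⁻¹' B ∩ a ⁻¹' {s} := by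
    intro s B
    ext y
    simp only [Set.mem_inter_iff, Set.mem_preimage, Set.mem_singleton_iff, φ]
    constructor
    · rintro ⟨h1, rfl⟩; exact ⟨h1, rfl⟩
    · rintro ⟨h1, rfl⟩; exact ⟨h1, rfl⟩
  have hφ : Measurable φ := by
    intro B hB
    have : φ ⁻¹' B = ⋃ s, (T s ⁻¹' B ∩ a ⁻¹' {s}) := by
      ext y
      simp [φ]
    rw [this]
    exact MeasurableSet.iUnion fun s => (hT s hB).inter (ha s)
  refine ⟨φ, ⟨hφ, ?_⟩, ?_⟩
  · ext B hB
    have ea := congrArg (fun μ : Measure I => μ (φ ⁻¹' B)) (sum_restrict_fibers ha)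
    have eb := congrArg (fun μ : Measure I => μ B) (sum_restrict_fibers hb)
    simp only [Measure.finsetSum_apply] at ea eb
    rw [Measure.map_apply hφ hB, ← ea, ← eb]
    refine Finset.sum_congr rfl fun s _ => ?_
    rw [← hTm s, Measure.map_apply (hT s) hB, Measure.restrict_apply (hφ hB), Measure.restrict_apply (hT s hB), hpre]
  · rw [← sum_restrict_fibers ha]
    rw [ae_iff, Measure.finsetSum_apply]
    refine Finset.sum_eq_zero fun s _ => ?_
    have h2 : ((volume : Measure I).restrict (b ⁻¹' {s})) (b ⁻¹' {s})ᶜ = 0 := by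
      rw [Measure.restrict_apply (hb s).compl]; simp
    rw [← hTm s, Measure.map_apply (hT s) (hb s).compl, Measure.restrict_apply (hT s (hb s).compl)] at h2
    rw [Measure.restrict_apply₀' (ha s).nullMeasurableSet]
    refine measure_mono_null ?_ h2
    rintro y ⟨h3, h4⟩
    refine ⟨?_, h4⟩
    simp only [Set.mem_preimage, Set.mem_singleton_iff] at h4
    subst h4
    exact h3

lemma sum_measure_fibers {T : Type*} [Fintype T] {a : I → T} (ha : ∀ s, MeasurableSet (a ⁻¹' {s})) :
    ∑ s, (volume : Measure I) (a ⁻¹' {s}) = 1 := by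
  have := congrArg (fun μ : Measure I => μ Set.univ) (sum_restrict_fibers ha)
  simpa [Measure.finsetSum_apply] using this

lemma label_coupling {T : Type*} [Fintype T] {a b : I → T} (ha : ∀ s, MeasurableSet (a ⁻¹' {s}))
    (hb : ∀ s, MeasurableSet (b ⁻¹' {s})) :
    ∃ φ : I → I, MeasurePreserving φ (volume : Measure I) (volume : Measure I) ∧
      (volume : Measure I).real {y | b (φ y) ≠ a y} ≤
        ∑ s, |(volume : Measure I).real (a ⁻¹' {s}) - (volume : Measure I).real (b ⁻¹' {s})| := by
  choose A hA hAm hAv using fun s => exists_sub_measure (ha s) (min_le_left _ ((volume : Measure I) (b ⁻¹' {s})))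
  choose B hB hBm hBv using fun s => exists_sub_measure (hb s) (min_le_right ((volume : Measure I) (a ⁻¹' {s})) _)
  have key : ∀ {a : I → T} (ha : ∀ s, MeasurableSet (a ⁻¹' {s})) {A : T → Set I} (hA : ∀ s, A s ⊆ a ⁻¹' {s})
      (hAm : ∀ s, MeasurableSet (A s)), ∃ a1 : I → Option T, (∀ s, a1 ⁻¹' {some s} = A s) ∧
        (∀ s, MeasurableSet (a1 ⁻¹' {s})) := by
    intro a ha A hA hAm
    refine ⟨fun y => if y ∈ A (a y) then some (a y) else none, ?_, ?_⟩
    · intro s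
      ext y
      simp only [Set.mem_preimage, Set.mem_singleton_iff]
      constructor
      · intro h
        split_ifs at h with h1
        · simp only [Option.some.injEq] at h; rw [← h]; exact h1
      · intro h
        have : a y = s := hA s h
        simp [this, h]
    · have h1 : ∀ s, (fun y => if y ∈ A (a y) then some (a y) else none) ⁻¹' {some s} = A s := by
        intro s
        ext y
        simp only [Set.mem_preimage, Set.mem_singleton_iff]
        constructor
        · intro h
          split_ifs at h with h1
          · simp only [Option.some.injEq] at h; rw [← h]; exact h1
        · intro h
          have : a y = s := hA s h
          simp [this, h]
      rintro (_ | s)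
      · have : (fun y => if y ∈ A (a y) then some (a y) else none) ⁻¹' {none} = (⋃ s, A s)ᶜ := by
          ext y
          simp only [Set.mem_preimage, Set.mem_singleton_iff, Set.mem_compl_iff, Set.mem_iUnion, not_exists]
          constructor
          · intro h s hs
            have : a y = s := hA s hs
            subst this
            simp [hs] at h
          · intro h
            simp [h (a y)]
        rw [this]
        exact (MeasurableSet.iUnion hAm).compl
      · rw [h1]; exact hAm s
  obtain ⟨a1, ha1, ha1m⟩ := key ha hA hAm
  obtain ⟨b1, hb1, hb1m⟩ := key hb hB hBm
  have hsa := sum_measure_fibers ha1m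
  have hsb := sum_measure_fibers hb1m
  rw [Fintype.sum_option] at hsa hsb
  simp only [ha1, hb1, hAv, hBv] at hsa hsb
  have hfin : ∑ s, min ((volume : Measure I) (a ⁻¹' {s})) ((volume : Measure I) (b ⁻¹' {s})) ≠ ⊤ :=
    ne_top_of_le_ne_top ENNReal.one_ne_top (hsa ▸ le_add_self)
  obtain ⟨φ, hφ, hφe⟩ := glue ha1m hb1m (by
    rintro (_ | s)
    · exact (ENNReal.add_left_inj hfin).1 (hsa.trans hsb.symm)
    · rw [ha1, hb1, hAv, hBv])
  refine ⟨φ, hφ, ?_⟩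
  have h1 : (volume : Measure I).real {y | b (φ y) ≠ a y} ≤ (volume : Measure I).real (a1 ⁻¹' {none}) := by
    refine ENNReal.toReal_mono (measure_ne_top _ _) (measure_mono_ae ?_)
    filter_upwards [hφe] with y hy h
    change a1 y = none
    by_contra hne
    obtain ⟨s, hs⟩ := Option.ne_none_iff_exists'.1 hne
    have h2 : y ∈ A s := by rw [← ha1]; exact hs
    have h3 : φ y ∈ B s := by rw [← hb1]; exact hy.trans hs
    have h4 : a y = s := hA s h2
    have h5 : b (φ y) = s := hB s h3
    exact h (h5.trans h4.symm)
  refine h1.trans ?_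
  have h2 : (volume : Measure I).real (a1 ⁻¹' {none}) + ∑ s, min ((volume : Measure I).real (a ⁻¹' {s}))
      ((volume : Measure I).real (b ⁻¹' {s})) = 1 := by
    have := congrArg ENNReal.toReal hsa
    rw [ENNReal.toReal_add (measure_ne_top _ _) hfin, ENNReal.toReal_sum (fun s _ =>
      ne_top_of_le_ne_top (measure_ne_top _ _) (min_le_left _ _))] at this
    simp only [ENNReal.toReal_min (measure_ne_top volume _) (measure_ne_top volume _)] at this
    simpa [Measure.real] using this
  have h3 : ∑ s, (volume : Measure I).real (a ⁻¹' {s}) = 1 := by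
    have := congrArg ENNReal.toReal (sum_measure_fibers ha)
    rw [ENNReal.toReal_sum (fun s _ => measure_ne_top _ _)] at this
    simpa [Measure.real] using this
  have h4 : (volume : Measure I).real (a1 ⁻¹' {none}) = ∑ s, ((volume : Measure I).real (a ⁻¹' {s}) -
      min ((volume : Measure I).real (a ⁻¹' {s})) ((volume : Measure I).real (b ⁻¹' {s}))) := by
    rw [Finset.sum_sub_distrib, h3]; linarith
  rw [h4]
  refine Finset.sum_le_sum fun s _ => ?_
  rcases le_total ((volume : Measure I).real (a ⁻¹' {s})) ((volume : Measure I).real (b ⁻¹' {s})) with h | h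
  · rw [min_eq_left h, sub_self]; exact abs_nonneg _
  · rw [min_eq_right h]; exact le_abs_self _

lemma moments_cont {J : Type} [Fintype J] {C : ℝ} (X : ℕ → I → (J → Set.Icc (-C) C))
    (X0 : I → (J → Set.Icc (-C) C)) (hX : ∀ n, Measurable (X n)) (hX0 : Measurable X0)
    (h : ∀ α : J → ℕ, Tendsto (fun n => ∫ y, ∏ j, (X n y j : ℝ) ^ α j) atTop (𝓝 (∫ y, ∏ j, (X0 y j : ℝ) ^ α j)))
    (f : C(J → Set.Icc (-C) C, ℝ)) :
    Tendsto (fun n => ∫ y, f (X n y)) atTop (𝓝 (∫ y, f (X0 y))) := by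
  let co : J → C(J → Set.Icc (-C) C, ℝ) := fun j => ⟨fun e => (e j : ℝ), by fun_prop⟩
  let A : Subalgebra ℝ C(J → Set.Icc (-C) C, ℝ) := Algebra.adjoin ℝ (Set.range co)
  have hbm : ∀ (f : C(J → Set.Icc (-C) C, ℝ)) {Y : I → (J → Set.Icc (-C) C)}, Measurable Y →
      Integrable (fun y => f (Y y)) (volume : Measure I) := by
    intro f Y hY
    refine Integrable.of_bound (f.continuous.measurable.comp hY).aestronglyMeasurable ‖f‖
      (Eventually.of_forall fun y => f.norm_coe_le_norm _)
  have hsep : A.SeparatesPoints := by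
    intro e e' hne
    obtain ⟨j, hj⟩ := Function.ne_iff.1 hne
    refine ⟨co j, ⟨co j, Algebra.subset_adjoin ⟨j, rfl⟩, rfl⟩, ?_⟩
    exact fun hh => hj (Subtype.ext hh)
  have hmon : ∀ g ∈ Submonoid.closure (Set.range co), ∃ α : J → ℕ, ∀ e, g e = ∏ j, (e j : ℝ) ^ α j := by
    intro g hg
    induction hg using Submonoid.closure_induction with
    | mem x hx =>
      obtain ⟨j, rfl⟩ := hx
      refine ⟨fun i => if i = j then 1 else 0, fun e => ?_⟩
      simp [co, pow_ite]
    | one => exact ⟨0, fun e => by simp⟩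
    | mul x y _ _ hx hy =>
      obtain ⟨α, hα⟩ := hx
      obtain ⟨β, hβ⟩ := hy
      exact ⟨α + β, fun e => by simp [hα, hβ, pow_add, Finset.prod_mul_distrib]⟩
  have hA : ∀ g ∈ A, Tendsto (fun n => ∫ y, g (X n y)) atTop (𝓝 (∫ y, g (X0 y))) := by
    intro g hg
    have hg' : g ∈ Submodule.span ℝ (Submonoid.closure (Set.range co) : Set C(J → Set.Icc (-C) C, ℝ)) := by
      rw [← Algebra.adjoin_eq_span]; exact hg
    induction hg' using Submodule.span_induction with
    | mem x hx =>
      obtain ⟨α, hα⟩ := hmon x hx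
      simpa only [hα] using h α
    | zero => simp
    | add x y hx hy ihx ihy =>
      simp only [ContinuousMap.add_apply]
      simp_rw [fun n => integral_add (hbm x (hX n)) (hbm y (hX n)), integral_add (hbm x hX0) (hbm y hX0)]
      exact (ihx (by change x ∈ Subalgebra.toSubmodule A; rw [Algebra.adjoin_eq_span]; exact hx)).add
        (ihy (by change y ∈ Subalgebra.toSubmodule A; rw [Algebra.adjoin_eq_span]; exact hy))
    | smul c x hx ih =>
      simp only [ContinuousMap.smul_apply, smul_eq_mul, integral_const_mul]
      exact (ih (by change x ∈ Subalgebra.toSubmodule A; rw [Algebra.adjoin_eq_span]; exact hx)).const_mul c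
  rw [Metric.tendsto_atTop]
  intro ε hε
  obtain ⟨⟨g, hg⟩, hgf⟩ := ContinuousMap.exists_mem_subalgebra_near_continuousMap_of_separatesPoints A hsep f (ε / 3) (by positivity)
  simp only at hgf
  obtain ⟨n0, hn0⟩ := Metric.tendsto_atTop.1 (hA g hg) (ε / 3) (by positivity)
  refine ⟨n0, fun n hn => ?_⟩
  have h1 := hn0 n hn
  have h2 : ∀ {Y : I → (J → Set.Icc (-C) C)}, Measurable Y → |(∫ y, g (Y y)) - ∫ y, f (Y y)| ≤ ‖g - f‖ := by
    intro Y hY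
    rw [← integral_sub (hbm g hY) (hbm f hY)]
    exact BM.abs_integral_le (fun y => (g - f).norm_coe_le_norm (Y y)) _
  have h3 := h2 (hX n)
  have h4 := h2 hX0
  rw [Real.dist_eq] at h1 ⊢
  rw [abs_lt] at *
  rw [abs_le] at *
  constructor <;> linarith [h1.1, h1.2, h3.1, h3.2, h4.1, h4.2]

lemma null_frontier_iInter {E : Type*} [TopologicalSpace E] [MeasurableSpace E] (μ : Measure E)
    {ι : Type*} [Finite ι] {A : ι → Set E} (h : ∀ i, μ (frontier (A i)) = 0) :
    μ (frontier (⋂ i, A i)) = 0 := by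
  have : Countable ι := Finite.to_countable
  refine measure_mono_null ?_ (measure_iUnion_null h)
  rintro x ⟨h1, h2⟩
  rw [interior_iInter_of_finite, Set.mem_iInter] at h2
  push Not at h2
  obtain ⟨i, hi⟩ := h2
  exact Set.mem_iUnion.2 ⟨i, closure_mono (Set.iInter_subset _ i) h1, hi⟩

lemma exists_labels {E : Type} [PseudoMetricSpace E] [CompactSpace E] [MeasurableSpace E] [BorelSpace E]
    (μ : Measure E) [IsProbabilityMeasure μ] {ε : ℝ} (hε : 0 < ε) :
    ∃ (T : Type) (_ : Fintype T) (l : E → T), (∀ s, MeasurableSet (l ⁻¹' {s})) ∧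
      (∀ s, μ (frontier (l ⁻¹' {s})) = 0) ∧ ∀ e e', l e = l e' → dist e e' < ε := by
  obtain ⟨t, -, htf, ht⟩ := finite_cover_balls_of_compact (isCompact_univ (X := E)) (e := ε / 4) (by positivity)
  choose r hr hr0 using fun x : E => exists_null_frontier_thickening μ {x} (show ε / 4 < ε / 2 by linarith)
  simp only [Metric.thickening_singleton] at hr0
  have : Finite t := htf
  have : Fintype t := Fintype.ofFinite t
  let l : E → (t → Prop) := fun e i => e ∈ Metric.ball (i : E) (r i)
  have hpre : ∀ s : t → Prop, l ⁻¹' {s} = ⋂ i : t, if s i then Metric.ball (i : E) (r i) else (Metric.ball (i : E) (r i))ᶜ := by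
    intro s
    ext e
    simp only [Set.mem_preimage, Set.mem_singleton_iff, Set.mem_iInter, funext_iff, l]
    refine forall_congr' fun i => ?_
    by_cases hs : s i <;> simp [hs]
  refine ⟨t → Prop, inferInstance, l, fun s => ?_, fun s => ?_, fun e e' h => ?_⟩
  · rw [hpre]
    refine MeasurableSet.iInter fun i => ?_
    split_ifs
    · exact Metric.isOpen_ball.measurableSet
    · exact Metric.isOpen_ball.measurableSet.compl
  · rw [hpre]
    refine null_frontier_iInter μ fun i => ?_
    split_ifs
    · exact hr0 _
    · rw [frontier_compl]; exact hr0 _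
  · obtain ⟨x, hx, hxe⟩ := Set.mem_iUnion₂.1 (ht (Set.mem_univ e))
    have h1 : e ∈ Metric.ball x (r x) := Metric.ball_subset_ball (hr x).1.le hxe
    have h2 : e' ∈ Metric.ball x (r x) := by
      have := congrFun h ⟨x, hx⟩
      simp only [l] at this
      exact this ▸ h1
    have := (hr x).2
    rw [Metric.mem_ball] at h1 h2
    linarith [dist_triangle_right e e' x]

lemma coupling {J : Type} [Fintype J] {C : ℝ} (hC : 0 < C) (X : ℕ → J → I → ℝ) (X0 : J → I → ℝ)
    (hX : ∀ n j, BM (X n j)) (hX0 : ∀ j, BM (X0 j)) (hXC : ∀ n j y, |X n j y| ≤ C) (hX0C : ∀ j y, |X0 j y| ≤ C)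
    (h : ∀ α : J → ℕ, Tendsto (fun n => ∫ y, ∏ j, X n j y ^ α j) atTop (𝓝 (∫ y, ∏ j, X0 j y ^ α j)))
    {ε : ℝ} (hε : 0 < ε) :
    ∀ᶠ n in atTop, ∃ φ : I → I, MeasurePreserving φ (volume : Measure I) (volume : Measure I) ∧
      ∀ j, ∫ y, |X n j y - X0 j (φ y)| ≤ ε := by
  let Y : ℕ → I → (J → Set.Icc (-C) C) := fun n y j => ⟨X n j y, abs_le.1 (hXC n j y)⟩
  let Y0 : I → (J → Set.Icc (-C) C) := fun y j => ⟨X0 j y, abs_le.1 (hX0C j y)⟩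
  have hY : ∀ n, Measurable (Y n) := fun n => measurable_pi_lambda _ fun j => (hX n j).1.subtype_mk
  have hY0 : Measurable Y0 := measurable_pi_lambda _ fun j => (hX0 j).1.subtype_mk
  let μ : ℕ → ProbabilityMeasure (J → Set.Icc (-C) C) := fun n =>
    ⟨(volume : Measure I).map (Y n), Measure.isProbabilityMeasure_map (hY n).aemeasurable⟩
  let μ0 : ProbabilityMeasure (J → Set.Icc (-C) C) :=
    ⟨(volume : Measure I).map Y0, Measure.isProbabilityMeasure_map hY0.aemeasurable⟩
  have hconv : Tendsto μ atTop (𝓝 μ0) := by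
    rw [ProbabilityMeasure.tendsto_iff_forall_integral_tendsto]
    intro f
    have := moments_cont Y Y0 hY hY0 h f.toContinuousMap
    have e : ∀ {Z : I → (J → Set.Icc (-C) C)}, Measurable Z →
        ∫ ω, f ω ∂((volume : Measure I).map Z) = ∫ y, f.toContinuousMap (Z y) := fun hZ =>
      integral_map hZ.aemeasurable f.continuous.measurable.aestronglyMeasurable
    simp only [μ, μ0, ProbabilityMeasure.coe_mk]
    simp_rw [fun n => e (hY n), e hY0]
    exact this
  obtain ⟨T, _, l, hl, hl0, hld⟩ := exists_labels (μ0 : Measure (J → Set.Icc (-C) C)) (half_pos hε)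
  have hm : ∀ {Z : I → (J → Set.Icc (-C) C)}, Measurable Z → ∀ s, MeasurableSet ((l ∘ Z) ⁻¹' {s}) := fun hZ s => hZ (hl s)
  have hsum : Tendsto (fun n => ∑ s, |(volume : Measure I).real ((l ∘ Y n) ⁻¹' {s}) - (volume : Measure I).real ((l ∘ Y0) ⁻¹' {s})|)
      atTop (𝓝 0) := by
    have : (0 : ℝ) = ∑ s : T, (0 : ℝ) := by simp
    rw [this]
    refine tendsto_finsetSum _ fun s _ => ?_
    have h1 := ProbabilityMeasure.tendsto_measure_of_null_frontier_of_tendsto' hconv (hl0 s)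
    simp only [μ, μ0, ProbabilityMeasure.coe_mk] at h1
    rw [Measure.map_apply hY0 (hl s)] at h1
    have h1' := h1.congr (fun n => Measure.map_apply (hY n) (hl s))
    have h2 := (ENNReal.tendsto_toReal (measure_ne_top _ _)).comp h1'
    have h3 := (h2.sub_const ((volume : Measure I).real ((l ∘ Y0) ⁻¹' {s}))).abs
    simpa [Measure.real, Set.preimage_comp] using h3
  have hev := hsum.eventually (gt_mem_nhds (show (0 : ℝ) < ε / 2 / (2 * C) by positivity))
  filter_upwards [hev] with n hn
  obtain ⟨φ, hφ, hφ2⟩ := label_coupling (hm (hY n)) (hm hY0)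
  refine ⟨φ, hφ, fun j => ?_⟩
  set D := {y | (l ∘ Y0) (φ y) ≠ (l ∘ Y n) y} with hD
  have hDm : MeasurableSet D := by
    have : D = ⋃ s, ((φ ⁻¹' ((l ∘ Y0) ⁻¹' {s}))ᶜ ∩ (l ∘ Y n) ⁻¹' {s}) := by
      ext y; simp [D]
    rw [this]
    exact MeasurableSet.iUnion fun s => (hφ.measurable (hm hY0 s)).compl.inter (hm (hY n) s)
  have hpt : ∀ y, |X n j y - X0 j (φ y)| ≤ ε / 2 + 2 * C * D.indicator (fun _ => (1 : ℝ)) y := by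
    intro y
    by_cases hy : y ∈ D
    · simp only [hy, Set.indicator_of_mem]
      have := abs_sub (X n j y) (X0 j (φ y))
      linarith [hXC n j y, hX0C j (φ y)]
    · simp only [hy, not_false_eq_true, Set.indicator_of_notMem]
      simp only [D, Set.mem_ofPred_eq, not_not, Function.comp] at hy
      have h1 := hld _ _ hy.symm
      have h2 := (dist_le_pi_dist (Y n y) (Y0 (φ y)) j).trans h1.le
      have h3 : dist (Y n y j) (Y0 (φ y) j) = |X n j y - X0 j (φ y)| := rfl
      linarith
  have hbm : BM (fun y => |X n j y - X0 j (φ y)|) := ((hX n j).sub ((hX0 j).comp hφ.measurable)).abs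
  have hint : Integrable (D.indicator (fun _ => (1 : ℝ))) (volume : Measure I) :=
    (integrable_const _).indicator hDm
  refine (integral_mono (hbm.integrable _) ((integrable_const _).add (hint.const_mul _)) hpt).trans ?_
  simp only [Pi.add_apply]
  rw [integral_add (integrable_const _) (hint.const_mul _), integral_const_mul, integral_indicator_const _ hDm]
  simp only [integral_const, probReal_univ, smul_eq_mul, one_mul, mul_one]
  have : (volume : Measure I).real D ≤ ε / 2 / (2 * C) := hφ2.trans hn.le
  rw [le_div_iff₀ (by positivity)] at this
  linarith

lemma kc_comp {K K' : I → I → ℝ} (hK : BMK K) (hK' : BMK K') {φ : I → I}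
    (hφ : MeasurePreserving φ (volume : Measure I) (volume : Measure I)) :
    kc (fun x y => K (φ x) (φ y)) (fun x y => K' (φ x) (φ y)) = fun x y => kc K K' (φ x) (φ y) := by
  ext x y
  have hb : BM (fun z => K (φ x) z * K' z (φ y)) := (hK.left _).mul (hK'.right _)
  have := integral_map (μ := (volume : Measure I)) (φ := φ) (f := fun z => K (φ x) z * K' z (φ y))
    hφ.measurable.aemeasurable (by rw [hφ.map_eq]; exact hb.1.aestronglyMeasurable)
  rw [hφ.map_eq] at this
  exact this.symm

lemma qk_comp {W : I → I → ℝ} (hW : IsGraphon W) {φ : I → I}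
    (hφ : MeasurePreserving φ (volume : Measure I) (volume : Measure I)) (N : ℕ) :
    qk (fun x y => W (φ x) (φ y)) N = fun x y => qk W N (φ x) (φ y) := by
  induction N with
  | zero => rfl
  | succ N ih =>
    have hD : BMK (kc W W) := BMK.kc hW.bm hW.bm
    simp only [qk]
    rw [ih, kc_comp hW.bm hW.bm hφ, kc_comp hD hW.bm hφ, kc_comp hD (qk_bm hW N) hφ,
      kc_comp hD (hD.kc (qk_bm hW N)) hφ]

lemma cutNorm_Ak_comp {W : I → I → ℝ} (hW : IsGraphon W) {φ : I → I}
    (hφ : MeasurePreserving φ (volume : Measure I) (volume : Measure I)) (N : ℕ) :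
    cutNorm (fun x y => W (φ x) (φ y) - kc (kc W W) (qk W N) (φ x) (φ y)) ^ 4 ≤ 1 / (2 * N + 1) := by
  have h := cutNorm_Ak (hW.comp hφ.measurable) N
  have hD : BMK (kc W W) := BMK.kc hW.bm hW.bm
  rw [qk_comp hW hφ, kc_comp hW.bm hW.bm hφ, kc_comp hD (qk_bm hW N) hφ] at h
  exact h

lemma cutNorm_tri {A1 D A2 : I → I → ℝ} (h1 : BMK A1) (hD : BMK D) (h2 : BMK A2) :
    cutNorm (fun x y => A1 x y + D x y - A2 x y) ≤
      cutNorm A1 + (∫ p : I × I, |D p.1 p.2| ∂lam2) + cutNorm A2 := by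
  refine cutNorm_le fun f g hf hg hf1 hg1 => ?_
  have hfb : BM (fun p : I × I => f p.1) := BM.comp ⟨hf, 1, hf1⟩ measurable_fst
  have hgb : BM (fun p : I × I => g p.2) := BM.comp ⟨hg, 1, hg1⟩ measurable_snd
  have i1 := ((BM.mul h1 hfb).mul hgb).integrable lam2
  have iD := ((BM.mul hD hfb).mul hgb).integrable lam2
  have i2 := ((BM.mul h2 hfb).mul hgb).integrable lam2
  have e : ∫ p : I × I, (A1 p.1 p.2 + D p.1 p.2 - A2 p.1 p.2) * f p.1 * g p.2 ∂lam2 =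
      (∫ p : I × I, A1 p.1 p.2 * f p.1 * g p.2 ∂lam2) + (∫ p : I × I, D p.1 p.2 * f p.1 * g p.2 ∂lam2)
        - ∫ p : I × I, A2 p.1 p.2 * f p.1 * g p.2 ∂lam2 := by
    rw [← integral_add' i1 iD, ← integral_sub' (i1.add iD) i2]
    congr 1; ext p; simp only [Pi.add_apply, Pi.sub_apply]; ring
  rw [e]
  have b1 := le_cutNorm h1 hf hg hf1 hg1
  have b2 := le_cutNorm h2 hf hg hf1 hg1
  have bD : |∫ p : I × I, D p.1 p.2 * f p.1 * g p.2 ∂lam2| ≤ ∫ p : I × I, |D p.1 p.2| ∂lam2 := by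
    refine (abs_integral_le_integral_abs).trans ?_
    refine integral_mono iD.abs ((BM.abs hD).integrable lam2) fun p => ?_
    simp only [abs_mul]
    have := mul_le_mul (hf1 p.1) (hg1 p.2) (abs_nonneg _) zero_le_one
    calc |D p.1 p.2| * |f p.1| * |g p.2| = |D p.1 p.2| * (|f p.1| * |g p.2|) := by ring
      _ ≤ |D p.1 p.2| * (1 * 1) := by exact mul_le_mul_of_nonneg_left this (abs_nonneg _)
      _ = _ := by ring
  refine (abs_sub _ _).trans (add_le_add ((abs_add_le _ _).trans (add_le_add b1 bD)) b2)

lemma L1_le_of_L2 {R : I → I → ℝ} (hR : BMK R) {ε : ℝ} (hε : 0 ≤ ε)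
    (h : ∫ p : I × I, R p.1 p.2 ^ 2 ∂lam2 ≤ ε ^ 2) : ∫ p : I × I, |R p.1 p.2| ∂lam2 ≤ ε := by
  have := sq_integral_le lam2 (BM.abs hR)
  simp only [sq_abs] at this
  exact le_of_pow_le_pow_left₀ (by norm_num) hε (this.trans h)

lemma integral_lam2_comp {R : I → I → ℝ} (hR : BMK R) {φ : I → I}
    (hφ : MeasurePreserving φ (volume : Measure I) (volume : Measure I)) :
    ∫ p : I × I, R (φ p.1) (φ p.2) ∂lam2 = ∫ p : I × I, R p.1 p.2 ∂lam2 := by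
  have h2 : MeasurePreserving (Prod.map φ φ) lam2 lam2 := hφ.prod hφ
  have hR' : BM (fun p : I × I => R p.1 p.2) := hR
  have := integral_map (μ := lam2) (φ := Prod.map φ φ) (f := fun p : I × I => R p.1 p.2)
    h2.measurable.aemeasurable (by rw [h2.map_eq]; exact hR'.1.aestronglyMeasurable)
  rw [h2.map_eq] at this
  exact this.symm

lemma BMK.comp2 {R : I → I → ℝ} (hR : BMK R) {φ : I → I} (hφ : Measurable φ) :
    BMK (fun x y => R (φ x) (φ y)) :=
  BM.comp hR (φ := fun p : I × I => (φ p.1, φ p.2)) (by fun_prop)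

lemma approx_diff {N k : ℕ} (hk : 0 < k) {W W' : GW} {x x' : Fin k → I} {C ε : ℝ} (hC0 : 0 < C)
    (hC : ∀ k W x j y, |feat N k W x j y| ≤ C) {φ : I → I}
    (hφ : MeasurePreserving φ (volume : Measure I) (volume : Measure I))
    (h : ∀ j, ∫ y, |feat N k W x j y - feat N k W' x' j (φ y)| ≤ ε) :
    ∫ p : I × I, |approxK N k W x p.1 p.2 - approxK N k W' x' (φ p.1) (φ p.2)| ∂lam2 ≤ 2 * C * ε := by
  have hk' : (0 : ℝ) < k := by exact_mod_cast hk
  let d : (Fin k ⊕ Fin k) → I → ℝ := fun j y => |feat N k W x j y - feat N k W' x' j (φ y)|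
  have hd : ∀ j, BM (d j) := fun j => ((feat_bm N k W x j).sub ((feat_bm N k W' x' j).comp hφ.measurable)).abs
  have hpt : ∀ p : I × I, |approxK N k W x p.1 p.2 - approxK N k W' x' (φ p.1) (φ p.2)| ≤
      (1 / (k : ℝ)) * ∑ i, (C * d (Sum.inl i) p.1 + C * d (Sum.inr i) p.2) := by
    intro p
    unfold approxK
    rw [← mul_sub, ← Finset.sum_sub_distrib, abs_mul, abs_of_pos (by positivity : 0 < 1 / (k : ℝ))]
    gcongr
    refine (Finset.abs_sum_le_sum_abs _ _).trans (Finset.sum_le_sum fun i _ => ?_)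
    have e : ∀ a b a' b' : ℝ, a * b - a' * b' = (a - a') * b + a' * (b - b') := fun a b a' b' => by ring
    rw [e]
    refine (abs_add_le _ _).trans (add_le_add ?_ ?_)
    · rw [abs_mul, mul_comm]
      exact mul_le_mul_of_nonneg_right (hC _ _ _ _ _) (abs_nonneg _)
    · rw [abs_mul]
      exact mul_le_mul_of_nonneg_right (hC _ _ _ _ _) (abs_nonneg _)
  have hb1 : ∀ j, BM (fun p : I × I => C * d j p.1) := fun j => (BM.const C).mul ((hd j).comp measurable_fst)
  have hb2 : ∀ j, BM (fun p : I × I => C * d j p.2) := fun j => (BM.const C).mul ((hd j).comp measurable_snd)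
  have hbs : BM (fun p : I × I => ∑ i, (C * d (Sum.inl i) p.1 + C * d (Sum.inr i) p.2)) :=
    BM.sum _ fun i _ => (hb1 _).add (hb2 _)
  have hL : BM (fun p : I × I => |approxK N k W x p.1 p.2 - approxK N k W' x' (φ p.1) (φ p.2)|) :=
    BM.abs (BM.sub (approx_bm N k W x) ((approx_bm N k W' x').comp2 hφ.measurable))
  refine (integral_mono (hL.integrable lam2) (((BM.const _).mul hbs).integrable lam2) hpt).trans ?_
  rw [integral_const_mul, integral_finsetSum _ fun i _ => ((hb1 _).add (hb2 _)).integrable lam2]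
  have e1 : ∀ j, ∫ p : I × I, C * d j p.1 ∂lam2 ≤ C * ε := fun j => by
    rw [integral_const_mul, integral_fun_fst]
    simp only [probReal_univ, one_smul]
    exact mul_le_mul_of_nonneg_left (h j) hC0.le
  have e2 : ∀ j, ∫ p : I × I, C * d j p.2 ∂lam2 ≤ C * ε := fun j => by
    rw [integral_const_mul, integral_fun_snd]
    simp only [probReal_univ, one_smul]
    exact mul_le_mul_of_nonneg_left (h j) hC0.le
  have hs : ∑ i : Fin k, ∫ p : I × I, (C * d (Sum.inl i) p.1 + C * d (Sum.inr i) p.2) ∂lam2 ≤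
      ∑ i : Fin k, (2 * C * ε) := by
    refine Finset.sum_le_sum fun i _ => ?_
    rw [integral_add ((hb1 _).integrable lam2) ((hb2 _).integrable lam2)]
    linarith [e1 (Sum.inl i), e2 (Sum.inr i)]
  calc _ ≤ (1 / (k : ℝ)) * ∑ i : Fin k, (2 * C * ε) := by gcongr
    _ = 2 * C * ε := by
      simp only [Finset.sum_const, Finset.card_univ, Fintype.card_fin, nsmul_eq_mul]
      field_simp

lemma P_bm (N : ℕ) (W : GW) : BMK (kc (kc W.1 W.1) (qk W.1 N)) :=
  (BMK.kc W.2.bm W.2.bm).kc (qk_bm W.2 N)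

lemma cut_bound {N k : ℕ} (hk : 0 < k) {W W' : GW} {x x' : Fin k → I} {C ε : ℝ} (hC0 : 0 < C) (hε : 0 < ε)
    (hN : 1 / (2 * (N : ℝ) + 1) ≤ ε ^ 4)
    (hC : ∀ k W x j y, |feat N k W x j y| ≤ C) {φ : I → I}
    (hφ : MeasurePreserving φ (volume : Measure I) (volume : Measure I))
    (h : ∀ j, ∫ y, |feat N k W x j y - feat N k W' x' j (φ y)| ≤ ε / (2 * C))
    (h1 : errK N k W x ≤ ε ^ 2) (h2 : errK N k W' x' ≤ ε ^ 2) :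
    cutDist W.1 W'.1 ≤ 5 * ε := by
  refine (cutDist_le hφ).trans ?_
  have c1 : cutNorm (fun x y => W.1 x y - kc (kc W.1 W.1) (qk W.1 N) x y) ≤ ε :=
    le_of_pow_le_pow_left₀ (by norm_num) hε.le ((cutNorm_Ak W.2 N).trans hN)
  have c2 : cutNorm (fun x y => W'.1 (φ x) (φ y) - kc (kc W'.1 W'.1) (qk W'.1 N) (φ x) (φ y)) ≤ ε :=
    le_of_pow_le_pow_left₀ (by norm_num) hε.le ((cutNorm_Ak_comp W'.2 hφ N).trans hN)
  have r1b : BMK (fun y y' => kc (kc W.1 W.1) (qk W.1 N) y y' - approxK N k W x y y') :=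
    BM.sub (P_bm N W) (approx_bm N k W x)
  have r2b : BMK (fun y y' => kc (kc W'.1 W'.1) (qk W'.1 N) y y' - approxK N k W' x' y y') :=
    BM.sub (P_bm N W') (approx_bm N k W' x')
  have r1 := L1_le_of_L2 r1b hε.le h1
  have r2 := L1_le_of_L2 r2b hε.le h2
  have r2abs : BMK (fun y y' => |kc (kc W'.1 W'.1) (qk W'.1 N) y y' - approxK N k W' x' y y'|) := BM.abs r2b
  rw [← integral_lam2_comp r2abs hφ] at r2
  have r3 := approx_diff hk hC0 hC hφ h
  have r3' : 2 * C * (ε / (2 * C)) = ε := by field_simp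
  rw [r3'] at r3
  have hDb : BMK (fun y y' => kc (kc W.1 W.1) (qk W.1 N) y y' - kc (kc W'.1 W'.1) (qk W'.1 N) (φ y) (φ y')) :=
    BM.sub (P_bm N W) ((P_bm N W').comp2 hφ.measurable)
  have hLb : BMK (fun y y' => approxK N k W x y y' - approxK N k W' x' (φ y) (φ y')) :=
    BM.sub (approx_bm N k W x) ((approx_bm N k W' x').comp2 hφ.measurable)
  have i1 := (BM.abs r1b).integrable lam2
  have i3 := (BM.abs hLb).integrable lam2
  have i2 := (BM.abs (r2b.comp2 hφ.measurable)).integrable lam2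
  have hD : ∫ p : I × I, |kc (kc W.1 W.1) (qk W.1 N) p.1 p.2 - kc (kc W'.1 W'.1) (qk W'.1 N) (φ p.1) (φ p.2)| ∂lam2 ≤ 3 * ε := by
    have hm := integral_mono ((BM.abs hDb).integrable lam2) ((i1.add i3).add i2) (fun p => by
      simp only [Pi.add_apply]
      refine le_trans (le_of_eq ?_) ((abs_sub _ _).trans (add_le_add (abs_add_le _ _) le_rfl))
      congr 1
      ring)
    rw [integral_add' (i1.add i3) i2, integral_add' i1 i3] at hm
    linarith
  have htri := cutNorm_tri (Ak_bm W.2 N) hDb ((Ak_bm W'.2 N).comp2 hφ.measurable)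
  have e : (fun y y' => W.1 y y' - W'.1 (φ y) (φ y')) = fun y y' =>
      (W.1 y y' - kc (kc W.1 W.1) (qk W.1 N) y y') +
      (kc (kc W.1 W.1) (qk W.1 N) y y' - kc (kc W'.1 W'.1) (qk W'.1 N) (φ y) (φ y')) -
      (W'.1 (φ y) (φ y') - kc (kc W'.1 W'.1) (qk W'.1 N) (φ y) (φ y')) := by
    ext y y'; ring
  rw [e]
  linarith

lemma backward {W : ℕ → GW} {Wl : GW} (h : HomConv W Wl) :
    Tendsto (fun n => cutDist (W n).1 Wl.1) atTop (𝓝 0) := by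
  rw [Metric.tendsto_atTop']
  intro ε' hε'
  obtain ⟨ε, hε, rfl⟩ : ∃ ε, 0 < ε ∧ ε' = 6 * ε := ⟨ε' / 6, by positivity, by ring⟩
  obtain ⟨N, hN⟩ : ∃ N : ℕ, 1 / (2 * (N : ℝ) + 1) ≤ ε ^ 4 := by
    obtain ⟨N, hN⟩ := exists_nat_gt (1 / ε ^ 4)
    refine ⟨N, ?_⟩
    rw [div_le_comm₀ (by positivity) (by positivity)]
    have : (0 : ℝ) ≤ N := Nat.cast_nonneg N
    linarith
  obtain ⟨C, hC0, hC⟩ := feat_bdd N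
  obtain ⟨k, hk⟩ := exists_nat_gt ((C * C) ^ 2 / ε ^ 2)
  have hk' : (0 : ℝ) < k := lt_of_le_of_lt (by positivity) hk
  have hk0 : 0 < k := by exact_mod_cast hk'
  obtain ⟨xs, x, hs, hx, hm⟩ := sample h N k hk0 hC
  have hlt : errK N k Wl xs < ε ^ 2 := by
    refine lt_of_le_of_lt hs ?_
    rwa [div_lt_comm₀ hk' (by positivity)]
  have hco := coupling hC0 (fun n => feat N k (W n) (x n)) (feat N k Wl xs) (fun n j => feat_bm _ _ _ _ _)
    (fun j => feat_bm _ _ _ _ _) (fun n j y => hC _ _ _ _ _) (fun j y => hC _ _ _ _ _) hm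
    (ε := ε / (2 * C)) (by positivity)
  have hev : ∀ᶠ n in atTop, cutDist (W n).1 Wl.1 ≤ 5 * ε := by
    filter_upwards [hco, hx.eventually (gt_mem_nhds hlt)] with n hn hn2
    obtain ⟨φ, hφ, hφ2⟩ := hn
    exact cut_bound hk0 hC0 hε hN hC hφ hφ2 hn2.le hlt.le
  obtain ⟨n0, hn0⟩ := eventually_atTop.1 hev
  refine ⟨n0, fun n hn => ?_⟩
  rw [Real.dist_eq, sub_zero, abs_of_nonneg (cutDist_nonneg _ _)]
  linarith [hn0 n hn.le]

/-- for graphons on `[0,1]`, convergence in the cut metric is equivalent to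
convergence of all homomorphism densities. -/
theorem cutDist_tendsto_zero_iff_homDensity_tendsto
    (W : ℕ → I → I → ℝ) (hW : ∀ n, IsGraphon (W n))
    (Wlim : I → I → ℝ) (hWlim : IsGraphon Wlim) :
    Tendsto (fun n => cutDist (W n) Wlim) atTop (𝓝 0) ↔
      ∀ (m : ℕ) (G : SimpleGraph (Fin m)),
        Tendsto (fun n => homDensity (volume : Measure I) (W n) G) atTop
          (𝓝 (homDensity (volume : Measure I) Wlim G)) := by
  refine ⟨forward W hW Wlim hWlim, fun h => ?_⟩
  exact backward (W := fun n => ⟨W n, hW n⟩) (Wl := ⟨Wlim, hWlim⟩) h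
end
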